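/- arXiv:1606.00312 — 2 statements merged into one kernel-verified Lean document; each statement's English description precedes it below -/
import Mathlib

section
/- Let (Ω,≤) be a totally ordered set on which Aut(Ω,≤) acts transitively. If Aut(Ω,≤) and Aut(ℚ,≤) are elementarily equivalent in the first-order language of lattice-ordered groups, then Ω is isomorphic as an ordered set either to ℚ or to ℝ∖ℚ (the set of irrational numbers with the order induced from ℝ). -/
/-!  Common framework for ℓ-permutation groups on a totally ordered set. -/

namespace LPerm

variable {Ω : Type*} [LinearOrder Ω]

/-- Pointwise join of two order automorphisms of a totally ordered set. -/
def autSup (f g : Ω ≃o Ω) : Ω ≃o Ω :=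
  Equiv.toOrderIso
    { toFun := fun α => max (f α) (g α)
      invFun := fun α => min (f.symm α) (g.symm α)
      left_inv := by
        intro α
        dsimp only
        rcases le_total (f α) (g α) with h | h
        · rw [max_eq_right h]
          have h1 : α ≤ f.symm (g α) := by
            have := f.symm.monotone h
            simpa using this
          rw [g.symm_apply_apply, min_eq_right h1]
        · rw [max_eq_left h]
          have h1 : α ≤ g.symm (f α) := by
            have := g.symm.monotone h
            simpa using this
          rw [f.symm_apply_apply, min_eq_left h1]
      right_inv := by
        intro α
        dsimp only
        rcases le_total (f.symm α) (g.symm α) with h | h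
        · rw [min_eq_left h]
          have h1 : g (f.symm α) ≤ α := by
            have := g.monotone h
            simpa using this
          rw [f.apply_symm_apply, max_eq_left h1]
        · rw [min_eq_right h]
          have h1 : f (g.symm α) ≤ α := by
            have := f.monotone h
            simpa using this
          rw [g.apply_symm_apply, max_eq_right h1] }
    (f.monotone.max g.monotone)
    (f.symm.monotone.min g.symm.monotone)

/-- Pointwise meet of two order automorphisms of a totally ordered set. -/
def autInf (f g : Ω ≃o Ω) : Ω ≃o Ω :=
  Equiv.toOrderIso
    { toFun := fun α => min (f α) (g α)
      invFun := fun α => max (f.symm α) (g.symm α)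
      left_inv := by
        intro α
        dsimp only
        rcases le_total (f α) (g α) with h | h
        · rw [min_eq_left h]
          have h1 : g.symm (f α) ≤ α := by
            have := g.symm.monotone h
            simpa using this
          rw [f.symm_apply_apply, max_eq_left h1]
        · rw [min_eq_right h]
          have h1 : f.symm (g α) ≤ α := by
            have := f.symm.monotone h
            simpa using this
          rw [g.symm_apply_apply, max_eq_right h1]
      right_inv := by
        intro α
        dsimp only
        rcases le_total (f.symm α) (g.symm α) with h | h
        · rw [max_eq_right h]
          have h1 : α ≤ f (g.symm α) := by
            have := f.monotone h
            simpa using this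
          rw [g.apply_symm_apply, min_eq_right h1]
        · rw [max_eq_left h]
          have h1 : α ≤ g (f.symm α) := by
            have := g.monotone h
            simpa using this
          rw [f.apply_symm_apply, min_eq_left h1] }
    (f.monotone.min g.monotone)
    (f.symm.monotone.max g.symm.monotone)


/-- The pointwise order on order automorphisms: `f ≤ g` iff `f α ≤ g α` for all `α`. -/
def autLe (f g : Ω ≃o Ω) : Prop := ∀ α : Ω, f α ≤ g α

/-- `|g| = g ∨ g⁻¹`. -/
def autAbs (g : Ω ≃o Ω) : Ω ≃o Ω := autSup g g⁻¹

/-- The support of an automorphism. -/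
def supp (g : Ω ≃o Ω) : Set Ω := {α | g α ≠ α}

/-- Conjugation, written `h^g = g⁻¹ h g` in the paper. -/
def aconj (h g : Ω ≃o Ω) : Ω ≃o Ω := g⁻¹ * h * g

/-- The commutator `[a,b] = a⁻¹ b⁻¹ a b`. -/
def pcomm (a b : Ω ≃o Ω) : Ω ≃o Ω := a⁻¹ * b⁻¹ * a * b

/-- `G` is closed under the pointwise lattice operations, i.e. `(G,Ω)` is an
ℓ-permutation group. -/
def SublatticeClosed (G : Subgroup (Ω ≃o Ω)) : Prop :=
  ∀ f g : Ω ≃o Ω, f ∈ G → g ∈ G → autSup f g ∈ G ∧ autInf f g ∈ G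

/-- `(G,Ω)` is transitive. -/
def IsTransitive (G : Subgroup (Ω ≃o Ω)) : Prop :=
  ∀ α β : Ω, ∃ g ∈ G, g α = β

/-- `(G,Ω)` is o-2 transitive. -/
def IsO2Transitive (G : Subgroup (Ω ≃o Ω)) : Prop :=
  ∀ α₁ α₂ β₁ β₂ : Ω, α₁ < α₂ → β₁ < β₂ → ∃ g ∈ G, g α₁ = β₁ ∧ g α₂ = β₂

/-- A convex `G`-congruence: an equivalence relation with convex classes which is
preserved by the action of `G`. -/
def IsConvexCongruence (G : Subgroup (Ω ≃o Ω)) (r : Ω → Ω → Prop) : Prop :=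
  Equivalence r ∧ (∀ α β γ : Ω, r α γ → α ≤ β → β ≤ γ → r α β) ∧
    ∀ g ∈ G, ∀ α β : Ω, r α β → r (g α) (g β)

/-- `V(α,β)`: the intersection of all convex `G`-congruences under which `α` and `β`
are equivalent. -/
def Vcong (G : Subgroup (Ω ≃o Ω)) (α β : Ω) : Ω → Ω → Prop :=
  fun γ δ => ∀ r : Ω → Ω → Prop, IsConvexCongruence G r → r α β → r γ δ

/-- Membership in the spine `𝔎` of `(G,Ω)`. -/
def SpineMem (G : Subgroup (Ω ≃o Ω)) (r : Ω → Ω → Prop) : Prop :=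
  ∃ α β : Ω, α ≠ β ∧ r = Vcong G α β

/-- Inclusion of relations. -/
def relLe (r s : Ω → Ω → Prop) : Prop := ∀ x y : Ω, r x y → s x y

/-- `Δ ∈ T`: `Δ` is an o-block (class) of a member of the spine `𝔎`. -/
def InT (G : Subgroup (Ω ≃o Ω)) (Δ : Set Ω) : Prop :=
  ∃ r : Ω → Ω → Prop, SpineMem G r ∧ ∃ δ : Ω, Δ = {γ | r δ γ}

/-- `Δ` is a class (o-block) of the relation `r`. -/
def IsBlockOf (r : Ω → Ω → Prop) (Δ : Set Ω) : Prop :=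
  ∃ δ : Ω, Δ = {γ | r δ γ}

/-- The restricted stabiliser `rst(S) = {g ∈ G ∣ supp g ⊆ S}`. -/
def rst (G : Subgroup (Ω ≃o Ω)) (S : Set Ω) : Set (Ω ≃o Ω) :=
  {g | g ∈ G ∧ supp g ⊆ S}

/-- The (setwise) stabiliser `st(Δ) = {g ∈ G ∣ Δg = Δ}`. -/
def stab (G : Subgroup (Ω ≃o Ω)) (Δ : Set Ω) : Set (Ω ≃o Ω) :=
  {g | g ∈ G ∧ g '' Δ = Δ}

/-- `Q_Δ = {h ∈ rst(Δ) ∣ ∃ α ∈ Δ, V(α, αh) = κ(Δ)}`; since `κ(Δ)` is the unique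
convex congruence having `Δ` as a class, the condition `V(α,αh) = κ(Δ)` says exactly
that `Δ` is the class of `V(α, αh)` containing `α`. -/
def Qset (G : Subgroup (Ω ≃o Ω)) (Δ : Set Ω) : Set (Ω ≃o Ω) :=
  {h | h ∈ rst G Δ ∧ ∃ α ∈ Δ, Δ = {γ | Vcong G α (h α) α γ}}

/-- `(G,Ω)` is ample: `Q_Δ ≠ ∅` for every `Δ ∈ T`. -/
def Ample (G : Subgroup (Ω ≃o Ω)) : Prop :=
  ∀ Δ : Set Ω, InT G Δ → (Qset G Δ).Nonempty

/-- `(G,Ω)` is abundant: for every `Δ ∈ T` and `g ∈ st(Δ)`, the automorphism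
`dep(g,Δ)` agreeing with `g` on `Δ` and with the identity elsewhere lies in `G`. -/
def Abundant (G : Subgroup (Ω ≃o Ω)) : Prop :=
  ∀ Δ : Set Ω, InT G Δ → ∀ g ∈ stab G Δ,
    ∃ g₀ ∈ G, (∀ α ∈ Δ, g₀ α = g α) ∧ ∀ α ∉ Δ, g₀ α = α

/-- The spine `𝔎` has no minimal element. -/
def SpineNoMin (G : Subgroup (Ω ≃o Ω)) : Prop :=
  ∀ r : Ω → Ω → Prop, SpineMem G r →
    ∃ r' : Ω → Ω → Prop, SpineMem G r' ∧ relLe r' r ∧ r' ≠ r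

/-- `Δ` is a minimal element of `T`. -/
def MinimalInT (G : Subgroup (Ω ≃o Ω)) (Δ : Set Ω) : Prop :=
  InT G Δ ∧ ∀ Δ' : Set Ω, InT G Δ' → Δ' ⊆ Δ → Δ' = Δ

/-- Hypothesis (†): if `T` has a minimal element `Δ₀`, then every (nondegenerate
bounded) interval of `Δ₀` supports a non-trivial element of `G`. -/
def Dagger (G : Subgroup (Ω ≃o Ω)) : Prop :=
  ∀ Δ₀ : Set Ω, MinimalInT G Δ₀ → ∀ α β : Ω, α ∈ Δ₀ → β ∈ Δ₀ → α < β →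
    ∃ g : Ω ≃o Ω, g ∈ G ∧ g ≠ 1 ∧ supp g ⊆ Set.Ioo α β

/-- `X_h = {[h⁻¹, h^g] ∣ g ∈ G}`. -/
def Xset (G : Subgroup (Ω ≃o Ω)) (h : Ω ≃o Ω) : Set (Ω ≃o Ω) :=
  {x | ∃ g ∈ G, x = pcomm h⁻¹ (aconj h g)}

/-- `W_h = ⋃ {X_{h^g} ∣ g ∈ G, [X_h, X_{h^g}] ≠ 1}`. -/
def Wset (G : Subgroup (Ω ≃o Ω)) (h : Ω ≃o Ω) : Set (Ω ≃o Ω) :=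
  {x | ∃ g ∈ G, (∃ a ∈ Xset G h, ∃ b ∈ Xset G (aconj h g), pcomm a b ≠ 1) ∧
    x ∈ Xset G (aconj h g)}

/-- The centraliser of a subset `S` in `G`. -/
def cent (G : Subgroup (Ω ≃o Ω)) (S : Set (Ω ≃o Ω)) : Set (Ω ≃o Ω) :=
  {f | f ∈ G ∧ ∀ s ∈ S, s * f = f * s}

/-- The double centraliser of a subset `S` in `G`. -/
def cent2 (G : Subgroup (Ω ≃o Ω)) (S : Set (Ω ≃o Ω)) : Set (Ω ≃o Ω) :=
  cent G (cent G S)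

/-- The pointwise stabiliser in `G` of a subset `S ⊆ Ω`. -/
def ptStab (G : Subgroup (Ω ≃o Ω)) (S : Set Ω) : Set (Ω ≃o Ω) :=
  {f | f ∈ G ∧ ∀ α ∈ S, f α = α}

/-- The congruence covered by `K`: the union of all convex `G`-congruences properly
contained in `K`. -/
def coveredRel (G : Subgroup (Ω ≃o Ω)) (K : Ω → Ω → Prop) : Ω → Ω → Prop :=
  fun γ δ => ∃ r : Ω → Ω → Prop, IsConvexCongruence G r ∧ relLe r K ∧ r ≠ K ∧ r γ δ

/-- `Γ ∈ π(Δ)`, where `K = κ(Δ)`: `Γ` is a class of the congruence covered by `K`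
contained in `Δ`. -/
def InPi (G : Subgroup (Ω ≃o Ω)) (K : Ω → Ω → Prop) (Δ Γ : Set Ω) : Prop :=
  ∃ δ ∈ Δ, Γ = {γ | coveredRel G K δ γ}

/-- An irreducible element of `G`. -/
def IsIrreducibleElt (G : Subgroup (Ω ≃o Ω)) (g : Ω ≃o Ω) : Prop :=
  autLe 1 g ∧ g ≠ 1 ∧
    ∀ g₁ g₂ : Ω ≃o Ω, g₁ ∈ G → g₂ ∈ G → autSup g₁ g₂ = g → autInf g₁ g₂ = 1 →
      g₁ = 1 ∨ g₂ = 1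

/-- `(G,Ω)` is controlled. -/
def Controlled (G : Subgroup (Ω ≃o Ω)) : Prop :=
  ∀ Δ : Set Ω, InT G Δ → ¬ MinimalInT G Δ → ∀ g ∈ rst G Δ,
    (∃ δ ∈ Δ ∩ supp g, Δ = {γ | Vcong G δ (g δ) δ γ}) ∨
      ∃ Δ' : Set Ω, InT G Δ' ∧ supp g ⊆ Δ' ∧ Δ' ⊂ Δ


/-- Function symbols of the first-order language of lattice-ordered groups:
multiplication, inversion, identity, join and meet. -/
inductive LGFunc : ℕ → Type
  | mul : LGFunc 2
  | inv : LGFunc 1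
  | one : LGFunc 0
  | join : LGFunc 2
  | meet : LGFunc 2

/-- The first-order language of lattice-ordered groups. -/
def LGLang : FirstOrder.Language where
  Functions := LGFunc
  Relations := fun _ => Empty

/-- The automorphism group of a totally ordered set as a structure for the
first-order language of lattice-ordered groups, with the pointwise lattice
operations. -/
noncomputable instance autLGStructure (Ω : Type*) [LinearOrder Ω] :
    LGLang.Structure (Ω ≃o Ω) where
  funMap {_} f x :=
    match f with
    | .mul => x 0 * x 1
    | .inv => (x 0)⁻¹
    | .one => 1
    | .join => autSup (x 0) (x 1)
    | .meet => autInf (x 0) (x 1)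
  RelMap {_} r _ := r.elim

section ElementaryEquivalence

open FirstOrder Language

/-! ### First-order definable predicates on automorphism groups -/

/-- `x` is positive: `x ∧ 1 = 1`. -/
def Pos (x : Ω ≃o Ω) : Prop := autInf x 1 = 1

/-- `x` and `y` are positive and have disjoint supports. -/
def Disj (x y : Ω ≃o Ω) : Prop := autInf x y = 1

/-- The support of `s` lies to the left of the support of `d`. -/
def LeftOf (s d : Ω ≃o Ω) : Prop := ∀ h, Pos h → Disj s (h * d * h⁻¹)

/-- The supports of `s` and `t` have the same upper bounds. -/
def SameSup (s t : Ω ≃o Ω) : Prop := ∀ d, Pos d → (LeftOf s d ↔ LeftOf t d)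

/-- `x` is a component of `b`: a union of bumps of `b`. -/
def Comp (x b : Ω ≃o Ω) : Prop := Disj x (x⁻¹ * b)

/-- `b` commutes with `g` and has no proper component commuting with `g`. -/
def IrrComm (g b : Ω ≃o Ω) : Prop :=
  Pos b ∧ b ≠ 1 ∧ g * b = b * g ∧ ∀ x, Comp x b → g * x = x * g → x = 1 ∨ x = b

/-- `a` is a bump of `b`. -/
def Atom (a b : Ω ≃o Ω) : Prop := Comp a b ∧ IrrComm 1 a

/-- `a` is a conjugate of a bump of `k` by a power of `g`. -/
def Mem (g k a : Ω ≃o Ω) : Prop :=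
  ∃ b, IrrComm g b ∧ Atom a b ∧ ∃ a', Atom a' b ∧ Atom a' k

/-- `s` is positive, nontrivial, and has support bounded above. -/
def Bdd (s : Ω ≃o Ω) : Prop := Pos s ∧ s ≠ 1 ∧ ∃ d, d ≠ 1 ∧ LeftOf s d

/-- The least upper bound of the support of `s` is that of a member of the family. -/
def SupMem (g k s : Ω ≃o Ω) : Prop := ∃ a, Mem g k a ∧ SameSup s a

/-- Every positive element displaces points far enough to leave room for three elements. -/
def HasRoom (Ω : Type*) [LinearOrder Ω] : Prop :=
  ∀ h : Ω ≃o Ω, Pos h → h ≠ 1 → ∃ d₁ d₂ d₃, d₁ ≠ 1 ∧ d₂ ≠ 1 ∧ d₃ ≠ 1 ∧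
    LeftOf d₁ d₂ ∧ LeftOf d₂ d₃ ∧ ∃ e, e = h * d₁ * h⁻¹ ∧ LeftOf d₃ e

/-- The supports of members of the family form a base. -/
def IsBaseFamily (g k : Ω ≃o Ω) : Prop :=
  ∀ c, Pos c → c ≠ 1 → ∃ a, Mem g k a ∧ ∀ x, Disj x c → Disj x a

/-- The set of suprema of members of the family is invariant. -/
def InvFamily (g k : Ω ≃o Ω) : Prop :=
  ∀ a, Mem g k a → ∀ f e, e = f * a * f⁻¹ → SupMem g k e

/-- The suprema not attained by the family form one orbit. -/
def CoFamilyTransitive (g k : Ω ≃o Ω) : Prop :=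
  ∀ s t, Bdd s → Bdd t → ¬ SupMem g k s → ¬ SupMem g k t →
    ∃ f e, e = f * s * f⁻¹ ∧ SameSup e t

/-- The first-order property distinguishing `ℚ` and `ℝ ∖ ℚ`. -/
def RatLike (Ω : Type*) [LinearOrder Ω] : Prop :=
  HasRoom Ω ∧ ∃ g g' k : Ω ≃o Ω, IrrComm g' k ∧ IsBaseFamily g k ∧ InvFamily g k ∧
    CoFamilyTransitive g k

/-! ### The defining formulas -/

/-- Universal quantification over a named variable. -/
noncomputable def allVar (x : ℕ) (φ : LGLang.Formula ℕ) : LGLang.Formula ℕ :=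
  Formula.iAlls Unit (φ.relabel fun y => if y = x then Sum.inr () else Sum.inl y)

/-- Existential quantification over a named variable. -/
noncomputable def exVar (x : ℕ) (φ : LGLang.Formula ℕ) : LGLang.Formula ℕ :=
  (allVar x φ.not).not

/-- A binary function symbol applied to two terms. -/
def bin (f : LGFunc 2) (s t : LGLang.Term ℕ) : LGLang.Term ℕ :=
  Term.func (L := LGLang) f ![s, t]

/-- The inverse of a term. -/
def invTerm (s : LGLang.Term ℕ) : LGLang.Term ℕ :=
  Term.func (L := LGLang) LGFunc.inv ![s]

/-- The constant term `1`. -/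
def oneTerm (α : Type) : LGLang.Term α :=
  Term.func (L := LGLang) LGFunc.one ![]

/-- The term naming a variable. -/
def vt (n : ℕ) : LGLang.Term ℕ := Term.var n

theorem realize_allVar {x : ℕ} {φ : LGLang.Formula ℕ} {v : ℕ → (Ω ≃o Ω)} :
    (allVar x φ).Realize v ↔ ∀ a, φ.Realize (Function.update v x a) := by
  have key : ∀ i : Unit → (Ω ≃o Ω),
      (Sum.elim v i ∘ fun y => if y = x then Sum.inr () else Sum.inl y) =
        Function.update v x (i ()) := by
    intro i
    funext y
    by_cases h : y = x
    · subst h; simp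
    · simp [h]
  rw [allVar, Formula.realize_iAlls]
  simp only [Formula.realize_relabel, key]
  exact ⟨fun h a => h fun _ => a, fun h i => h (i ())⟩

theorem realize_exVar {x : ℕ} {φ : LGLang.Formula ℕ} {v : ℕ → (Ω ≃o Ω)} :
    (exVar x φ).Realize v ↔ ∃ a, φ.Realize (Function.update v x a) := by
  simp [exVar, Formula.realize_not, realize_allVar]

theorem realize_oneTerm {α : Type} {v : α → (Ω ≃o Ω)} : (oneTerm α).realize v = 1 := rfl

theorem realize_vt {n : ℕ} {v : ℕ → (Ω ≃o Ω)} : (vt n).realize v = v n := rfl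

theorem realize_iffFormula {φ ψ : LGLang.Formula ℕ} {v : ℕ → (Ω ≃o Ω)} :
    Formula.Realize (φ.iff ψ) v ↔ (φ.Realize v ↔ ψ.Realize v) := BoundedFormula.realize_iff

theorem realize_supFormula {φ ψ : LGLang.Formula ℕ} {v : ℕ → (Ω ≃o Ω)} :
    Formula.Realize (φ ⊔ ψ) v ↔ (φ.Realize v ∨ ψ.Realize v) := BoundedFormula.realize_sup

/-- The conjugate `f * s * f⁻¹` as a term. -/
def conjTerm (f s : ℕ) : LGLang.Term ℕ :=
  bin LGFunc.mul (bin LGFunc.mul (vt f) (vt s)) (invTerm (vt f))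

/-- Equality of terms as a formula. -/
def eqF (s t : LGLang.Term ℕ) : LGLang.Formula ℕ := Term.equal s t

theorem realize_eqF {s t : LGLang.Term ℕ} {v : ℕ → (Ω ≃o Ω)} :
    (eqF s t).Realize v ↔ s.realize v = t.realize v := Formula.realize_equal

/-- Formula for `Disj`. -/
def disjF (s t : LGLang.Term ℕ) : LGLang.Formula ℕ :=
  eqF (bin LGFunc.meet s t) (oneTerm ℕ)

/-- Formula for `Pos`. -/
def posF (s : LGLang.Term ℕ) : LGLang.Formula ℕ := disjF s (oneTerm ℕ)

/-- Formula for `x ≠ 1`. -/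
def neOneF (x : ℕ) : LGLang.Formula ℕ := (eqF (vt x) (oneTerm ℕ)).not

/-- Formula for `LeftOf`. -/
noncomputable def leftOfF (s d : ℕ) : LGLang.Formula ℕ :=
  allVar (s + d + 1) ((posF (vt (s + d + 1))).imp (disjF (vt s) (conjTerm (s + d + 1) d)))

/-- Formula for `SameSup`. -/
noncomputable def sameSupF (s t : ℕ) : LGLang.Formula ℕ :=
  allVar (s + t + 1) ((posF (vt (s + t + 1))).imp
    (BoundedFormula.iff (leftOfF s (s + t + 1)) (leftOfF t (s + t + 1))))

/-- Formula for `Comp`. -/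
def compF (x b : ℕ) : LGLang.Formula ℕ :=
  disjF (vt x) (bin LGFunc.mul (invTerm (vt x)) (vt b))

/-- Formula for commuting elements. -/
def commF (g b : LGLang.Term ℕ) : LGLang.Formula ℕ :=
  eqF (bin LGFunc.mul g b) (bin LGFunc.mul b g)

/-- Formula for `IrrComm`, with a fresh variable `z`. -/
noncomputable def irrCommF (g : LGLang.Term ℕ) (b z : ℕ) : LGLang.Formula ℕ :=
  posF (vt b) ⊓ (neOneF b ⊓ (commF g (vt b) ⊓
    allVar z ((compF z b).imp ((commF g (vt z)).imp
      (eqF (vt z) (oneTerm ℕ) ⊔ eqF (vt z) (vt b))))))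

/-- Formula for `Atom`. -/
noncomputable def atomF (a b : ℕ) : LGLang.Formula ℕ :=
  compF a b ⊓ irrCommF (oneTerm ℕ) a (a + 1)

/-- Formula for `Mem`. -/
noncomputable def memF (g k a : ℕ) : LGLang.Formula ℕ :=
  exVar (g + k + a + 1) (irrCommF (vt g) (g + k + a + 1) (g + k + a + 2) ⊓
    (atomF a (g + k + a + 1) ⊓ exVar (g + k + a + 2)
      (atomF (g + k + a + 2) (g + k + a + 1) ⊓ atomF (g + k + a + 2) k)))

/-- Formula for `Bdd`. -/
noncomputable def bddF (s : ℕ) : LGLang.Formula ℕ :=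
  posF (vt s) ⊓ (neOneF s ⊓ exVar (s + 1) (neOneF (s + 1) ⊓ leftOfF s (s + 1)))

/-- Formula for `SupMem`. -/
noncomputable def supMemF (g k s : ℕ) : LGLang.Formula ℕ :=
  exVar (g + k + s + 1) (memF g k (g + k + s + 1) ⊓ sameSupF s (g + k + s + 1))

/-- Formula for `HasRoom`. -/
noncomputable def hasRoomF : LGLang.Formula ℕ :=
  allVar 0 ((posF (vt 0)).imp ((neOneF 0).imp (exVar 1 (exVar 2 (exVar 3
    (neOneF 1 ⊓ (neOneF 2 ⊓ (neOneF 3 ⊓ (leftOfF 1 2 ⊓ (leftOfF 2 3 ⊓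
      exVar 4 (eqF (vt 4) (conjTerm 0 1) ⊓ leftOfF 3 4)))))))))))

/-- Formula for `IsBaseFamily` with parameters `0` and `2`. -/
noncomputable def baseF : LGLang.Formula ℕ :=
  allVar 3 ((posF (vt 3)).imp ((neOneF 3).imp (exVar 4 (memF 0 2 4 ⊓
    allVar 5 ((disjF (vt 5) (vt 3)).imp (disjF (vt 5) (vt 4)))))))

/-- Formula for `InvFamily` with parameters `0` and `2`. -/
noncomputable def invF : LGLang.Formula ℕ :=
  allVar 3 ((memF 0 2 3).imp (allVar 4 (allVar 5
    ((eqF (vt 5) (conjTerm 4 3)).imp (supMemF 0 2 5)))))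

/-- Formula for `CoFamilyTransitive` with parameters `0` and `2`. -/
noncomputable def coTransF : LGLang.Formula ℕ :=
  allVar 3 (allVar 4 ((bddF 3).imp ((bddF 4).imp ((supMemF 0 2 3).not.imp
    ((supMemF 0 2 4).not.imp (exVar 5 (exVar 6
      (eqF (vt 6) (conjTerm 5 3) ⊓ sameSupF 6 4))))))))

/-- Formula for `RatLike`. -/
noncomputable def ratLikeF : LGLang.Formula ℕ :=
  hasRoomF ⊓ exVar 0 (exVar 1 (exVar 2
    (irrCommF (vt 1) 2 3 ⊓ (baseF ⊓ (invF ⊓ coTransF)))))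

section Realize

variable {v : ℕ → (Ω ≃o Ω)}

theorem realize_disjF {s t : LGLang.Term ℕ} :
    (disjF s t).Realize v ↔ Disj (s.realize v) (t.realize v) := realize_eqF

theorem realize_posF {s : LGLang.Term ℕ} : (posF s).Realize v ↔ Pos (s.realize v) :=
  realize_eqF

theorem realize_neOneF {x : ℕ} : (neOneF x).Realize v ↔ v x ≠ 1 := by
  rw [neOneF, Formula.realize_not, realize_eqF]; rfl

theorem realize_conjTerm {f s : ℕ} : (conjTerm f s).realize v = v f * v s * (v f)⁻¹ := rfl

theorem realize_leftOfF {s d : ℕ} : (leftOfF s d).Realize v ↔ LeftOf (v s) (v d) := by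
  have h1 : s ≠ s + d + 1 := by omega
  have h2 : d ≠ s + d + 1 := by omega
  simp only [leftOfF, realize_allVar, Formula.realize_imp, realize_posF, realize_disjF,
    realize_conjTerm, realize_vt, Function.update_self, Function.update_of_ne h1,
    Function.update_of_ne h2, LeftOf]

theorem realize_sameSupF {s t : ℕ} : (sameSupF s t).Realize v ↔ SameSup (v s) (v t) := by
  have h1 : s ≠ s + t + 1 := by omega
  have h2 : t ≠ s + t + 1 := by omega
  simp only [sameSupF, realize_allVar, Formula.realize_imp, realize_posF, realize_iffFormula,
    realize_leftOfF, realize_vt, Function.update_self, Function.update_of_ne h1,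
    Function.update_of_ne h2, SameSup]

theorem realize_compF {x b : ℕ} : (compF x b).Realize v ↔ Comp (v x) (v b) := realize_disjF

theorem realize_commF {g b : LGLang.Term ℕ} :
    (commF g b).Realize v ↔ g.realize v * b.realize v = b.realize v * g.realize v :=
  realize_eqF

theorem realize_irrCommF {g : LGLang.Term ℕ} {b z : ℕ} (hb : b ≠ z)
    (hg : ∀ x, g.realize (Function.update v z x) = g.realize v) :
    (irrCommF g b z).Realize v ↔ IrrComm (g.realize v) (v b) := by
  simp only [irrCommF, realize_allVar, Formula.realize_imp, Formula.realize_inf, realize_posF,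
    realize_neOneF, realize_compF, realize_commF, realize_supFormula, realize_eqF,
    realize_oneTerm, realize_vt, Function.update_self, Function.update_of_ne hb, hg, IrrComm]

theorem realize_atomF {a b : ℕ} : (atomF a b).Realize v ↔ Atom (v a) (v b) := by
  rw [atomF, Formula.realize_inf, realize_compF,
    realize_irrCommF (by omega) (fun _ => rfl)]
  rfl

theorem realize_memF {g k a : ℕ} : (memF g k a).Realize v ↔ Mem (v g) (v k) (v a) := by
  have h1 : g ≠ g + k + a + 1 := by omega
  have h2 : k ≠ g + k + a + 1 := by omega
  have h3 : a ≠ g + k + a + 1 := by omega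
  have h4 : g ≠ g + k + a + 2 := by omega
  have h5 : k ≠ g + k + a + 2 := by omega
  have h6 : g + k + a + 1 ≠ g + k + a + 2 := by omega
  have hirr : ∀ w : ℕ → (Ω ≃o Ω),
      (irrCommF (vt g) (g + k + a + 1) (g + k + a + 2)).Realize w ↔
        IrrComm (w g) (w (g + k + a + 1)) := fun w =>
    realize_irrCommF h6 fun x => by rw [realize_vt, realize_vt, Function.update_of_ne h4]
  simp only [memF, realize_exVar, Formula.realize_inf, hirr, realize_atomF,
    Function.update_self, Function.update_of_ne h1, Function.update_of_ne h2,
    Function.update_of_ne h3, Function.update_of_ne h5,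
    Function.update_of_ne h6, Mem]

theorem realize_bddF {s : ℕ} : (bddF s).Realize v ↔ Bdd (v s) := by
  have h1 : s ≠ s + 1 := by omega
  simp only [bddF, realize_exVar, Formula.realize_inf, realize_posF, realize_neOneF,
    realize_leftOfF, realize_vt, Function.update_self, Function.update_of_ne h1, Bdd]

theorem realize_supMemF {g k s : ℕ} :
    (supMemF g k s).Realize v ↔ SupMem (v g) (v k) (v s) := by
  have h1 : g ≠ g + k + s + 1 := by omega
  have h2 : k ≠ g + k + s + 1 := by omega
  have h3 : s ≠ g + k + s + 1 := by omega
  simp only [supMemF, realize_exVar, Formula.realize_inf, realize_memF, realize_sameSupF,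
    Function.update_self, Function.update_of_ne h1, Function.update_of_ne h2,
    Function.update_of_ne h3, SupMem]

theorem realize_hasRoomF : hasRoomF.Realize v ↔ HasRoom Ω := by
  simp [hasRoomF, realize_allVar, realize_exVar, Formula.realize_imp, realize_posF,
    realize_neOneF, realize_leftOfF, realize_eqF, realize_conjTerm, realize_vt,
    HasRoom]

theorem realize_baseF : baseF.Realize v ↔ IsBaseFamily (v 0) (v 2) := by
  simp [baseF, realize_allVar, realize_exVar, Formula.realize_imp, realize_posF,
    realize_neOneF, realize_memF, realize_disjF, realize_vt,
    IsBaseFamily]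

theorem realize_invF : invF.Realize v ↔ InvFamily (v 0) (v 2) := by
  simp [invF, realize_allVar, Formula.realize_imp, realize_supMemF, realize_eqF,
    realize_conjTerm, realize_memF, realize_vt, InvFamily]

theorem realize_coTransF : coTransF.Realize v ↔ CoFamilyTransitive (v 0) (v 2) := by
  simp [coTransF, realize_allVar, realize_exVar, Formula.realize_imp, Formula.realize_not,
    realize_supMemF, realize_eqF, realize_sameSupF, realize_bddF,
    realize_conjTerm, realize_vt, CoFamilyTransitive]

theorem realize_ratLikeF : ratLikeF.Realize v ↔ RatLike Ω := by
  have hirr : ∀ w : ℕ → (Ω ≃o Ω), (irrCommF (vt 1) 2 3).Realize w ↔ IrrComm (w 1) (w 2) :=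
    fun w => realize_irrCommF (by omega) fun x => by
      rw [realize_vt, realize_vt, Function.update_of_ne (by omega)]
  simp [ratLikeF, realize_exVar, realize_hasRoomF, realize_baseF, realize_invF,
    realize_coTransF, hirr, RatLike]

end Realize

theorem ratLike_of_elementarilyEquivalent {Ω Ω' : Type*} [LinearOrder Ω] [LinearOrder Ω']
    (h : LGLang.ElementarilyEquivalent (Ω ≃o Ω) (Ω' ≃o Ω')) (h' : RatLike Ω') :
    RatLike Ω := by
  let σ : LGLang.Sentence := BoundedFormula.subst ratLikeF fun _ => oneTerm Empty
  have key : ∀ (X : Type _) [LinearOrder X], (X ≃o X) ⊨ σ ↔ RatLike X := by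
    intro X _
    rw [Sentence.Realize, Formula.Realize, BoundedFormula.realize_subst]
    exact realize_ratLikeF
  have key' : ∀ (X : Type _) [LinearOrder X], (X ≃o X) ⊨ σ ↔ RatLike X := by
    intro X _
    rw [Sentence.Realize, Formula.Realize, BoundedFormula.realize_subst]
    exact realize_ratLikeF
  exact (key Ω).1 (((elementarilyEquivalent_iff).1 h σ).2 ((key' Ω').2 h'))

/-! ### Pointwise meaning of the predicates -/

section Pointwise

variable {a b c d f g h s t x y : Ω ≃o Ω} {α β γ : Ω}

theorem autSup_apply (f g : Ω ≃o Ω) (α : Ω) : autSup f g α = max (f α) (g α) := rfl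

theorem autInf_apply (f g : Ω ≃o Ω) (α : Ω) : autInf f g α = min (f α) (g α) := rfl

theorem pos_iff : Pos x ↔ ∀ α, α ≤ x α := by
  simp only [Pos, DFunLike.ext_iff, autInf_apply, RelIso.coe_one, id, min_eq_right_iff]

theorem disj_iff : Disj x y ↔ Pos x ∧ Pos y ∧ ∀ α, x α = α ∨ y α = α := by
  simp only [pos_iff, Disj, DFunLike.ext_iff, autInf_apply, RelIso.coe_one, id]
  constructor
  · intro h
    refine ⟨fun α => ?_, fun α => ?_, fun α => ?_⟩
    · exact (h α).symm.le.trans (min_le_left _ _)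
    · exact (h α).symm.le.trans (min_le_right _ _)
    · rcases min_choice (x α) (y α) with h1 | h1
      · exact Or.inl (h1.symm.trans (h α))
      · exact Or.inr (h1.symm.trans (h α))
  · rintro ⟨h1, h2, h3⟩ α
    rcases h3 α with h | h
    · rw [h, min_eq_left (h2 α)]
    · rw [h, min_eq_right (h1 α)]

theorem apply_inv_eq_iff : x⁻¹ α = β ↔ α = x β := x.toEquiv.symm_apply_eq

theorem conj_apply : (f * d * f⁻¹) α = f (d (f⁻¹ α)) := rfl

theorem conj_fix_iff : (f * d * f⁻¹) α = α ↔ d (f⁻¹ α) = f⁻¹ α := by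
  rw [conj_apply, ← apply_inv_eq_iff.trans eq_comm, eq_comm]

theorem supp_conj : supp (f * d * f⁻¹) = f '' supp d := by
  ext α
  change ¬ _ ↔ _
  rw [conj_fix_iff]
  constructor
  · intro hα
    exact ⟨f⁻¹ α, hα, RelIso.apply_inv_self f α⟩
  · rintro ⟨β, hβ, rfl⟩
    rw [RelIso.inv_apply_self]
    exact hβ

theorem Pos.conj (hd : Pos d) (f : Ω ≃o Ω) : Pos (f * d * f⁻¹) := by
  rw [pos_iff] at hd ⊢
  intro α
  rw [conj_apply]
  conv_lhs => rw [← RelIso.apply_inv_self f α]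
  exact f.monotone (hd _)

theorem ne_one_iff : x ≠ 1 ↔ (supp x).Nonempty := by
  rw [Ne, DFunLike.ext_iff, not_forall]
  rfl

theorem Pos.lt (hx : Pos x) (hα : α ∈ supp x) : α < x α :=
  lt_of_le_of_ne (pos_iff.1 hx α) (Ne.symm hα)

theorem apply_mem_supp : x α ∈ supp x ↔ α ∈ supp x := by
  simp [supp]

theorem inv_apply_mem_supp : x⁻¹ α ∈ supp x ↔ α ∈ supp x := by
  rw [← apply_mem_supp, RelIso.apply_inv_self]

theorem Pos.inv_lt (hx : Pos x) (hα : α ∈ supp x) : x⁻¹ α < α := by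
  have := hx.lt (inv_apply_mem_supp.2 hα)
  rwa [RelIso.apply_inv_self] at this

theorem Ioo_subset_supp : Set.Ioo α (x α) ⊆ supp x := by
  rintro β ⟨h1, h2⟩ h3
  exact absurd (x.strictMono h1) (by rw [h3]; exact h2.not_gt)

theorem leftOf_of_forall (hs : Pos s) (hd : Pos d) (h : ∀ σ ∈ supp s, ∀ δ ∈ supp d, σ < δ) :
    LeftOf s d := by
  intro k hk
  refine disj_iff.2 ⟨hs, hd.conj k, fun α => ?_⟩
  by_contra! hα
  have h1 : α ∈ k '' supp d := by
    rw [← supp_conj]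
    exact hα.2
  obtain ⟨δ, hδ, rfl⟩ := h1
  exact (h _ hα.1 δ hδ).not_ge (pos_iff.1 hk δ)

theorem LeftOf.pos_left (h : LeftOf s d) : Pos s :=
  (disj_iff.1 (h 1 (pos_iff.2 fun _ => le_rfl))).1

theorem LeftOf.lt (htrans : ∀ α β : Ω, ∃ g : Ω ≃o Ω, g α = β) (h : LeftOf s d)
    (hα : α ∈ supp s) (hβ : β ∈ supp d) : α < β := by
  by_contra! hle
  obtain ⟨f, hf⟩ := htrans β α
  have hpos : Pos (autSup f 1) := pos_iff.2 fun γ => le_max_right _ _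
  have hk : autSup f 1 β = α := by
    rw [autSup_apply, hf, RelIso.coe_one, id, max_eq_left hle]
  rcases (disj_iff.1 (h _ hpos)).2.2 α with h1 | h1
  · exact hα h1
  · have h2 : α ∈ supp (autSup f 1 * d * (autSup f 1)⁻¹) := by
      rw [supp_conj]
      exact ⟨β, hβ, hk⟩
    exact h2 h1

theorem leftOf_iff (htrans : ∀ α β : Ω, ∃ g : Ω ≃o Ω, g α = β) (hs : Pos s) (hd : Pos d) :
    LeftOf s d ↔ supp d ⊆ upperBounds (supp s) := by
  constructor
  · intro h β hβ α hα
    exact (h.lt htrans hα hβ).le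
  · intro h
    refine leftOf_of_forall hs hd fun σ hσ δ hδ => ?_
    exact (h (inv_apply_mem_supp.2 hδ) hσ).trans_lt (hd.inv_lt hδ)

theorem sameSup_of_upperBounds_eq (htrans : ∀ α β : Ω, ∃ g : Ω ≃o Ω, g α = β)
    (hs : Pos s) (ht : Pos t) (h : upperBounds (supp s) = upperBounds (supp t)) :
    SameSup s t := by
  intro d hd
  rw [leftOf_iff htrans hs hd, leftOf_iff htrans ht hd, h]

theorem comp_iff (hb : Pos b) : Comp x b ↔ ∀ α, x α = α ∨ x α = b α := by
  have key : ∀ α, (x⁻¹ * b) α = α ↔ x α = b α := fun α => by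
    rw [RelIso.mul_apply, apply_inv_eq_iff, eq_comm]
  rw [Comp, disj_iff]
  simp only [key]
  refine ⟨fun h => h.2.2, fun h => ⟨?_, ?_, h⟩⟩
  · refine pos_iff.2 fun α => ?_
    rcases h α with h | h <;> rw [h]
    exact pos_iff.1 hb α
  · refine pos_iff.2 fun α => ?_
    rw [RelIso.mul_apply, ← x.le_iff_le, RelIso.apply_inv_self]
    rcases h α with h | h <;> rw [h]
    exact pos_iff.1 hb α

theorem Comp.pos (h : Comp x b) : Pos x := (disj_iff.1 h).1

theorem Comp.supp_subset (hb : Pos b) (h : Comp x b) : supp x ⊆ supp b := by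
  intro α hα hbα
  rcases (comp_iff hb).1 h α with h1 | h1
  · exact hα h1
  · exact hα (h1.trans hbα)

theorem Comp.apply_eq (hb : Pos b) (h : Comp x b) (hα : α ∈ supp x) : x α = b α :=
  ((comp_iff hb).1 h α).resolve_left hα

theorem eq_of_atom_of_meet (hb : Pos b) (hx : Atom x b) (hy : Atom y b)
    (h1 : α ∈ supp x) (h2 : α ∈ supp y) : x = y := by
  have hxc := (comp_iff hb).1 hx.1
  have hyc := (comp_iff hb).1 hy.1
  have hle := pos_iff.1 hb
  have hne : autInf x y ≠ 1 := by
    refine ne_one_iff.2 ⟨α, ?_⟩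
    change min (x α) (y α) ≠ α
    rw [hx.1.apply_eq hb h1, ← hy.1.apply_eq hb h2, min_self]
    exact h2
  have e1 : autInf x y = x := by
    refine (hx.2.2.2.2 (autInf x y) ((comp_iff hx.1.pos).2 fun β => ?_) (by simp)).resolve_left hne
    rw [autInf_apply]
    rcases hxc β with h | h <;> rcases hyc β with h' | h' <;> rw [h, h'] <;>
      simp [hle β]
  have e2 : autInf x y = y := by
    refine (hy.2.2.2.2 (autInf x y) ((comp_iff hy.1.pos).2 fun β => ?_) (by simp)).resolve_left hne
    rw [autInf_apply]
    rcases hxc β with h | h <;> rcases hyc β with h' | h' <;> rw [h, h'] <;>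
      simp [hle β]
  exact e1.symm.trans e2

end Pointwise

/-! ### Gluing automorphisms -/

section Glue

theorem exists_glue (A : Set (Ω ≃o Ω))
    (hA : ∀ a ∈ A, ∀ b ∈ A, ∀ α ∈ supp a, α ∈ supp b → a = b) :
    ∃ F : Ω ≃o Ω, (∀ a ∈ A, ∀ α ∈ supp a, F α = a α) ∧
      ∀ α, (∀ a ∈ A, α ∉ supp a) → F α = α := by
  classical
  let G (e : (Ω ≃o Ω) → (Ω ≃o Ω)) (α : Ω) : Ω :=
    if h : ∃ a ∈ A, α ∈ supp a then e h.choose α else α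
  have hG1 : ∀ e, ∀ a ∈ A, ∀ α ∈ supp a, G e α = e a α := by
    intro e a ha α hα
    have h : ∃ a ∈ A, α ∈ supp a := ⟨a, ha, hα⟩
    have : h.choose = a := hA _ h.choose_spec.1 _ ha α h.choose_spec.2 hα
    simp only [G, dif_pos h, this]
  have hG2 : ∀ e α, (∀ a ∈ A, α ∉ supp a) → G e α = α := by
    intro e α hα
    have h : ¬ ∃ a ∈ A, α ∈ supp a := by simpa using hα
    simp only [G, dif_neg h]
  have hlr : Function.LeftInverse (G fun a => a⁻¹) (G id) := by
    intro α
    by_cases h : ∃ a ∈ A, α ∈ supp a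
    · obtain ⟨a, ha, hα⟩ := h
      rw [hG1 id a ha α hα, id, hG1 _ a ha _ (apply_mem_supp.2 hα)]
      exact RelIso.inv_apply_self a α
    · have h : ∀ a ∈ A, α ∉ supp a := by simpa using h
      rw [hG2 _ α h, hG2 _ α h]
  have hrl : Function.RightInverse (G fun a => a⁻¹) (G id) := by
    intro α
    by_cases h : ∃ a ∈ A, α ∈ supp a
    · obtain ⟨a, ha, hα⟩ := h
      rw [hG1 _ a ha α hα, hG1 _ a ha _ (inv_apply_mem_supp.2 hα)]
      exact RelIso.apply_inv_self a α
    · have h : ∀ a ∈ A, α ∉ supp a := by simpa using h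
      rw [hG2 _ α h, hG2 _ α h]
  have hmono : StrictMono (G id) := by
    intro α β hαβ
    by_cases h : ∃ a ∈ A, α ∈ supp a
    · obtain ⟨a, ha, hα⟩ := h
      rw [hG1 id a ha α hα, id]
      by_cases hβa : β ∈ supp a
      · rw [hG1 id a ha β hβa]
        exact a.strictMono hαβ
      have h1 : a α < β := by
        have := a.strictMono hαβ
        rwa [not_not.1 hβa] at this
      by_cases h' : ∃ b ∈ A, β ∈ supp b
      · obtain ⟨b, hb, hβ⟩ := h'
        rw [hG1 id b hb β hβ, id]
        have h2 : b (a α) = a α := by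
          by_contra h3
          have := hA a ha b hb _ (apply_mem_supp.2 hα) h3
          exact hβa (this ▸ hβ)
        rw [← h2]
        exact b.strictMono h1
      · rwa [hG2 id β (by simpa using h')]
    · rw [hG2 id α (by simpa using h)]
      by_cases h' : ∃ b ∈ A, β ∈ supp b
      · obtain ⟨b, hb, hβ⟩ := h'
        rw [hG1 id b hb β hβ, id]
        have h3 : b α = α := by
          by_contra h3
          exact h ⟨b, hb, h3⟩
        rw [← h3]
        exact b.strictMono hαβ
      · rwa [hG2 id β (by simpa using h')]
  refine ⟨hmono.orderIsoOfSurjective _ hrl.surjective, fun a ha α hα => ?_, fun α hα => ?_⟩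
  · exact hG1 id a ha α hα
  · exact hG2 id α hα

theorem exists_restrict (h : Ω ≃o Ω) (Δ : Set Ω) (hinv : ∀ α, h α ∈ Δ ↔ α ∈ Δ)
    (hΔ : Δ.OrdConnected) :
    ∃ c : Ω ≃o Ω, (∀ α ∈ Δ, c α = h α) ∧ ∀ α ∉ Δ, c α = α := by
  classical
  let F (α : Ω) : Ω := if α ∈ Δ then h α else α
  have h1 : ∀ α ∈ Δ, F α = h α := fun α hα => if_pos hα
  have h2 : ∀ α ∉ Δ, F α = α := fun α hα => if_neg hα
  have hmono : StrictMono F := by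
    intro α β hαβ
    by_cases hα : α ∈ Δ <;> by_cases hβ : β ∈ Δ
    · rw [h1 α hα, h1 β hβ]
      exact h.strictMono hαβ
    · rw [h1 α hα, h2 β hβ]
      by_contra! hle
      exact hβ (hΔ.out hα ((hinv α).2 hα) ⟨hαβ.le, hle⟩)
    · rw [h2 α hα, h1 β hβ]
      by_contra! hle
      exact hα (hΔ.out ((hinv β).2 hβ) hβ ⟨hle, hαβ.le⟩)
    · rwa [h2 α hα, h2 β hβ]
  have hsurj : Function.Surjective F := by
    intro β
    by_cases hβ : β ∈ Δ
    · refine ⟨h⁻¹ β, ?_⟩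
      rw [h1 _ ((hinv _).1 (by rwa [RelIso.apply_inv_self])), RelIso.apply_inv_self]
    · exact ⟨β, h2 β hβ⟩
  exact ⟨hmono.orderIsoOfSurjective _ hsurj, h1, h2⟩

/-- The conjugates of `a` by the powers of `g`. -/
def zconj (g a : Ω ≃o Ω) (n : ℤ) : Ω ≃o Ω := g ^ n * a * (g ^ n)⁻¹

variable {a b g k : Ω ≃o Ω}

theorem zconj_zero : zconj g a 0 = a := by simp [zconj]

theorem zconj_succ (n : ℤ) : zconj g a (n + 1) = g * zconj g a n * g⁻¹ := by
  rw [zconj, zconj, add_comm, zpow_add, zpow_one]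
  group

theorem zconj_zconj (m n : ℤ) : zconj g (zconj g a m) n = zconj g a (n + m) := by
  simp only [zconj, zpow_add]
  group

theorem supp_zconj (n : ℤ) : supp (zconj g a n) = (g ^ n : Ω ≃o Ω) '' supp a := supp_conj

theorem apply_mem_supp_zconj {n : ℤ} {α : Ω} :
    g α ∈ supp (zconj g a (n + 1)) ↔ α ∈ supp (zconj g a n) := by
  rw [zconj_succ, supp_conj, g.injective.mem_set_image]

theorem zconj_apply_comm {n : ℤ} {α : Ω} :
    zconj g a (n + 1) (g α) = g (zconj g a n α) := by
  rw [zconj_succ, conj_apply, RelIso.inv_apply_self]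

theorem Comp.zconj (hb : Pos b) (hgb : g * b = b * g) (h : Comp a b) (n : ℤ) :
    Comp (zconj g a n) b := by
  have hc : Commute (g ^ n) b := Commute.zpow_left hgb n
  rw [comp_iff hb] at h ⊢
  intro α
  have h2 : b α = (g ^ n) (b ((g ^ n)⁻¹ α)) := by
    rw [← RelIso.mul_apply, hc.eq, RelIso.mul_apply, RelIso.apply_inv_self]
  have h1 : LPerm.zconj g a n α = (g ^ n) (a ((g ^ n)⁻¹ α)) := rfl
  rcases h ((g ^ n)⁻¹ α) with h | h
  · left
    rw [h1, h, RelIso.apply_inv_self]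
  · right
    rw [h1, h, h2]

theorem IrrComm.conj (h : IrrComm 1 a) (f : Ω ≃o Ω) : IrrComm 1 (f * a * f⁻¹) := by
  refine ⟨h.1.conj f, ?_, by simp, fun x hx _ => ?_⟩
  · obtain ⟨α, hα⟩ := ne_one_iff.1 h.2.1
    exact ne_one_iff.2 (by rw [supp_conj]; exact ⟨f α, α, hα, rfl⟩)
  · have hx' : Comp (f⁻¹ * x * f) a := by
      rw [comp_iff (h.1.conj f)] at hx
      rw [comp_iff h.1]
      intro α
      have := hx (f α)
      rw [conj_apply, RelIso.inv_apply_self] at this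
      have e : (f⁻¹ * x * f) α = f⁻¹ (x (f α)) := rfl
      rcases this with h' | h'
      · left; rw [e, h', RelIso.inv_apply_self]
      · right; rw [e, h', RelIso.inv_apply_self]
    rcases h.2.2.2 _ hx' (by simp) with h' | h'
    · left
      calc x = f * (f⁻¹ * x * f) * f⁻¹ := by group
        _ = 1 := by rw [h']; group
    · right
      rw [← h']
      group

theorem Atom.zconj (hb : Pos b) (hgb : g * b = b * g) (h : Atom a b) (n : ℤ) :
    Atom (zconj g a n) b := ⟨h.1.zconj hb hgb n, h.2.conj _⟩

/-- An automorphism obtained by gluing an orbit of conjugates commutes with the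
conjugating element. -/
theorem comm_of_glue {F : Ω ≃o Ω} (h1 : ∀ n, ∀ α ∈ supp (zconj g a n), F α = zconj g a n α)
    (h2 : ∀ α, (∀ n, α ∉ supp (zconj g a n)) → F α = α) : g * F = F * g := by
  ext α
  rw [RelIso.mul_apply, RelIso.mul_apply]
  by_cases h : ∃ n, α ∈ supp (zconj g a n)
  · obtain ⟨n, hn⟩ := h
    rw [h1 n α hn, h1 (n + 1) _ (apply_mem_supp_zconj.2 hn), zconj_apply_comm]
  · push Not at h
    rw [h2 α h, h2]
    intro n hn
    refine h (n - 1) (apply_mem_supp_zconj.1 ?_)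
    rwa [sub_add_cancel]

theorem exists_zconj_eq (hb : IrrComm g b) {a a' : Ω ≃o Ω} (ha : Atom a b)
    (ha' : Atom a' b) : ∃ n, a' = zconj g a n := by
  obtain ⟨F, hF1, hF2⟩ := exists_glue (Set.range (zconj g a)) (by
    rintro _ ⟨m, rfl⟩ _ ⟨n, rfl⟩ α h1 h2
    exact eq_of_atom_of_meet hb.1 (ha.zconj hb.1 hb.2.2.1 m) (ha.zconj hb.1 hb.2.2.1 n) h1 h2)
  simp only [Set.forall_mem_range] at hF1 hF2
  have hcomp : Comp F b := by
    rw [comp_iff hb.1]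
    intro α
    by_cases h : ∃ n, α ∈ supp (zconj g a n)
    · obtain ⟨n, hn⟩ := h
      right
      rw [hF1 n α hn, (ha.zconj hb.1 hb.2.2.1 n).1.apply_eq hb.1 hn]
    · push Not at h
      exact Or.inl (hF2 α h)
  have hne : F ≠ 1 := by
    obtain ⟨α, hα⟩ := ne_one_iff.1 ha.2.2.1
    refine ne_one_iff.2 ⟨α, ?_⟩
    have h0 := hF1 0 α (by rwa [zconj_zero])
    rw [zconj_zero] at h0
    change F α ≠ α
    rw [h0]
    exact hα
  have hFb := (hb.2.2.2 F hcomp (comm_of_glue hF1 hF2)).resolve_left hne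
  obtain ⟨α, hα⟩ := ne_one_iff.1 ha'.2.2.1
  have hαF : F α ≠ α := by
    rw [hFb]
    exact ha'.1.supp_subset hb.1 hα
  by_contra! hcon
  refine hαF (hF2 α fun n hn => hcon n ?_)
  exact eq_of_atom_of_meet hb.1 ha' (ha.zconj hb.1 hb.2.2.1 n) hα hn

theorem irrComm_of_glue (ha : IrrComm 1 a) {F : Ω ≃o Ω}
    (h1 : ∀ n, ∀ α ∈ supp (zconj g a n), F α = zconj g a n α)
    (h2 : ∀ α, (∀ n, α ∉ supp (zconj g a n)) → F α = α) :
    IrrComm g F ∧ ∀ n, Atom (zconj g a n) F := by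
  have hirr : ∀ n, IrrComm 1 (zconj g a n) := fun n => ha.conj _
  have hpos : Pos F := by
    refine pos_iff.2 fun α => ?_
    by_cases h : ∃ n, α ∈ supp (zconj g a n)
    · obtain ⟨n, hn⟩ := h
      rw [h1 n α hn]
      exact pos_iff.1 (hirr n).1 α
    · push Not at h
      rw [h2 α h]
  have hatom : ∀ n, Atom (zconj g a n) F := by
    refine fun n => ⟨(comp_iff hpos).2 fun α => ?_, hirr n⟩
    by_cases h : α ∈ supp (zconj g a n)
    · exact Or.inr (h1 n α h).symm
    · exact Or.inl (not_not.1 h)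
  have hcomm := comm_of_glue h1 h2
  refine ⟨⟨hpos, ?_, hcomm, fun x hx hgx => ?_⟩, hatom⟩
  · obtain ⟨α, hα⟩ := ne_one_iff.1 ha.2.1
    exact ne_one_iff.2 ⟨α, (hatom 0).1.supp_subset hpos (by rwa [zconj_zero])⟩
  · by_cases hx1 : x = 1
    · exact Or.inl hx1
    right
    have hxF := (comp_iff hpos).1 hx
    obtain ⟨α, hα⟩ := ne_one_iff.1 hx1
    have hn : ∃ n, α ∈ supp (zconj g a n) := by
      by_contra! h
      exact hx.supp_subset hpos hα (h2 α h)
    obtain ⟨n, hn⟩ := hn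
    have hinf : autInf x (zconj g a n) = zconj g a n := by
      refine ((hirr n).2.2.2 (autInf x (zconj g a n))
        ((comp_iff (hirr n).1).2 fun β => ?_) (by simp)).resolve_left ?_
      · rw [autInf_apply]
        by_cases hβ : β ∈ supp (zconj g a n)
        · rw [← h1 n β hβ]
          rcases hxF β with h | h
          · left; rw [h, min_eq_left (pos_iff.1 hpos β)]
          · right; rw [h, min_self]
        · left
          rw [not_not.1 hβ, min_eq_right (pos_iff.1 hx.pos β)]
      · refine ne_one_iff.2 ⟨α, ?_⟩
        change min (x α) (zconj g a n α) ≠ α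
        rw [← h1 n α hn, hx.apply_eq hpos hα, min_self, h1 n α hn]
        exact hn
    have hsub : supp (zconj g a n) ⊆ supp x := by
      intro β hβ h
      refine hβ ?_
      rw [← hinf, autInf_apply, h]
      exact min_eq_left (pos_iff.1 (hirr n).1 β)
    have hall : ∀ m, supp (zconj g a m) ⊆ supp x := by
      intro m
      have e : zconj g a m = zconj g (zconj g a n) (m - n) := by
        rw [zconj_zconj, sub_add_cancel]
      have hc : Commute (g ^ (m - n)) x := Commute.zpow_left hgx _
      rw [e, supp_zconj]
      rintro _ ⟨β, hβ, rfl⟩ h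
      rw [← RelIso.mul_apply, ← hc.eq, RelIso.mul_apply, EmbeddingLike.apply_eq_iff_eq] at h
      exact hsub hβ h
    ext β
    by_cases h : ∃ m, β ∈ supp (zconj g a m)
    · obtain ⟨m, hm⟩ := h
      exact hx.apply_eq hpos (hall m hm)
    · push Not at h
      rw [h2 β h]
      by_contra hβ
      exact hx.supp_subset hpos hβ (h2 β h)

theorem Mem.eq_zconj {g g' k a a₀ : Ω ≃o Ω} (ha : Mem g k a) (hk : IrrComm g' k)
    (h₀ : Atom a₀ k) : ∃ m n, a = zconj g (zconj g' a₀ n) m := by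
  obtain ⟨b, hb, hab, a', ha'b, ha'k⟩ := ha
  obtain ⟨n, hn⟩ := exists_zconj_eq hk h₀ ha'k
  obtain ⟨m, hm⟩ := exists_zconj_eq hb ha'b hab
  exact ⟨m, n, by rw [hm, hn]⟩

theorem countable_mem {g g' k : Ω ≃o Ω} (hk : IrrComm g' k) : {a | Mem g k a}.Countable := by
  by_cases h : ∃ a₀, Atom a₀ k
  · obtain ⟨a₀, h₀⟩ := h
    refine (Set.countable_range fun p : ℤ × ℤ => zconj g (zconj g' a₀ p.1) p.2).mono ?_
    intro a ha
    obtain ⟨m, n, h⟩ := Mem.eq_zconj ha hk h₀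
    exact ⟨(n, m), h.symm⟩
  · refine Set.countable_empty.mono ?_
    rintro a ⟨b, hb, hab, a', ha'b, ha'k⟩
    exact h ⟨a', ha'k⟩

theorem Mem.irr {g k a : Ω ≃o Ω} (h : Mem g k a) : IrrComm 1 a := by
  obtain ⟨b, -, hab, -⟩ := h
  exact hab.2

end Glue

/-! ### Consequences of `RatLike` -/

section Room

theorem zpow_strictMono {h : Ω ≃o Ω} {α : Ω} (hα : α < h α) :
    StrictMono fun n : ℤ => (h ^ n : Ω ≃o Ω) α := by
  refine strictMono_int_of_lt_succ fun n => ?_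
  rw [zpow_add_one, RelIso.mul_apply]
  exact (h ^ n).strictMono hα

theorem exists_supp_subset_Ioo (htrans : ∀ α β : Ω, ∃ g : Ω ≃o Ω, g α = β) (hroom : HasRoom Ω)
    {α β : Ω} (hαβ : α < β) : ∃ d : Ω ≃o Ω, Pos d ∧ d ≠ 1 ∧ supp d ⊆ Set.Ioo α β := by
  obtain ⟨h, rfl⟩ := htrans α β
  have hmono := zpow_strictMono hαβ
  have hfin : ∀ d : Ω ≃o Ω, ∀ N : ℤ, Pos d → d ≠ 1 →
      supp d ⊆ Set.Ioo ((h ^ N : Ω ≃o Ω) α) ((h ^ (N + 1) : Ω ≃o Ω) α) →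
      ∃ d : Ω ≃o Ω, Pos d ∧ d ≠ 1 ∧ supp d ⊆ Set.Ioo α (h α) := by
    intro d N hd hd1 hsub
    refine ⟨zconj h d (-N), hd.conj _, ?_, ?_⟩
    · rw [ne_one_iff] at hd1 ⊢
      rw [supp_zconj]
      exact hd1.image _
    · rw [supp_zconj]
      rintro _ ⟨γ, hγ, rfl⟩
      have h1 := (h ^ (-N) : Ω ≃o Ω).strictMono (hsub hγ).1
      have h2 := (h ^ (-N) : Ω ≃o Ω).strictMono (hsub hγ).2
      rw [← RelIso.mul_apply, ← zpow_add, neg_add_cancel] at h1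
      rw [← RelIso.mul_apply (h ^ (-N)) (h ^ (N + 1)), ← zpow_add, neg_add_cancel_left,
        zpow_one] at h2
      exact ⟨by simpa using h1, h2⟩
  let Δ : Set Ω := {x | (∃ m : ℤ, (h ^ m : Ω ≃o Ω) α ≤ x) ∧ ∃ n : ℤ, x ≤ (h ^ n : Ω ≃o Ω) α}
  have hα : α ∈ Δ := ⟨⟨0, by simp⟩, ⟨0, by simp⟩⟩
  have hinv : ∀ x, h x ∈ Δ ↔ x ∈ Δ := by
    have e : ∀ n : ℤ, h ((h ^ (n - 1) : Ω ≃o Ω) α) = (h ^ n : Ω ≃o Ω) α := fun n => by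
      rw [← RelIso.mul_apply, ← zpow_one_add, add_sub_cancel]
    have e' : ∀ n : ℤ, (h ^ (n + 1) : Ω ≃o Ω) α = h ((h ^ n : Ω ≃o Ω) α) := fun n => by
      rw [← RelIso.mul_apply, ← zpow_one_add, add_comm]
    intro x
    constructor
    · rintro ⟨⟨m, hm⟩, ⟨n, hn⟩⟩
      exact ⟨⟨m - 1, by rwa [← h.le_iff_le, e]⟩, ⟨n - 1, by rwa [← h.le_iff_le, e]⟩⟩
    · rintro ⟨⟨m, hm⟩, ⟨n, hn⟩⟩
      exact ⟨⟨m + 1, by rw [e']; exact h.monotone hm⟩, ⟨n + 1, by rw [e']; exact h.monotone hn⟩⟩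
  obtain ⟨c, hc1, hc2⟩ := exists_restrict h Δ hinv
    ⟨fun x hx y hy z hz => ⟨hx.1.imp fun m hm => hm.trans hz.1, hy.2.imp fun n hn => hz.2.trans hn⟩⟩
  have hlt : ∀ x ∈ Δ, x < h x := by
    rintro x ⟨⟨m, hm⟩, ⟨n, hn⟩⟩
    by_contra! hle
    have hx : ∀ j : ℕ, (h ^ j : Ω ≃o Ω) x ≤ x := fun j => by
      induction j with
      | zero => simp
      | succ j ih =>
        rw [pow_succ, RelIso.mul_apply]
        exact ((h ^ j).monotone hle).trans ih
    have h1 : (h ^ m : Ω ≃o Ω) α < (h ^ (n + 1) : Ω ≃o Ω) α :=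
      hm.trans_lt (hn.trans_lt (hmono (lt_add_one n)))
    have hmn : m < n + 1 := hmono.lt_iff_lt.1 h1
    have h2 := (h ^ (n + 1 - m).toNat).monotone hm
    have h3 : (h ^ (n + 1 - m).toNat : Ω ≃o Ω) = h ^ (n + 1 - m) := by
      rw [← zpow_natCast, Int.toNat_of_nonneg (by omega)]
    have h4 := hx (n + 1 - m).toNat
    rw [h3] at h2 h4
    rw [← RelIso.mul_apply, ← zpow_add, sub_add_cancel] at h2
    exact absurd (h2.trans (h4.trans hn)) (not_le.2 (hmono (lt_add_one n)))
  have hcpos : Pos c := pos_iff.2 fun x => by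
    by_cases hx : x ∈ Δ
    · rw [hc1 x hx]
      exact (hlt x hx).le
    · rw [hc2 x hx]
  have hcne : c ≠ 1 := ne_one_iff.2 ⟨α, by change c α ≠ α; rw [hc1 α hα]; exact hαβ.ne'⟩
  obtain ⟨d₁, d₂, d₃, hd₁, hd₂, hd₃, h12, h23, e, he, h3e⟩ := hroom c hcpos hcne
  subst he
  obtain ⟨δ, hδ⟩ := ne_one_iff.1 hd₁
  have hcδ : c δ ∈ supp (c * d₁ * c⁻¹) := by
    rw [supp_conj]
    exact ⟨δ, hδ, rfl⟩
  obtain ⟨τ, hτ⟩ := ne_one_iff.1 hd₂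
  obtain ⟨υ, hυ⟩ := ne_one_iff.1 hd₃
  have hδΔ : δ ∈ Δ := by
    by_contra hcon
    have h1 := ((h12.lt htrans hδ hτ).trans (h23.lt htrans hτ hυ)).trans (h3e.lt htrans hυ hcδ)
    rw [hc2 δ hcon] at h1
    exact lt_irrefl _ h1
  rw [hc1 δ hδΔ] at hcδ
  obtain ⟨N, hN, hNmax⟩ := Int.exists_greatest_of_bdd (P := fun z => (h ^ z : Ω ≃o Ω) α ≤ δ)
    (by
      obtain ⟨n, hn⟩ := hδΔ.2
      exact ⟨n, fun z hz => hmono.le_iff_le.1 (hz.trans hn)⟩) hδΔ.1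
  have hN1 : δ < (h ^ (N + 1) : Ω ≃o Ω) α := by
    by_contra! hcon
    exact absurd (hNmax _ hcon) (by omega)
  have hN2 : h δ < (h ^ (N + 1 + 1) : Ω ≃o Ω) α := by
    rw [add_comm (N + 1), zpow_one_add, RelIso.mul_apply]
    exact h.strictMono hN1
  by_cases hcase : ∃ x ∈ supp d₂, (h ^ (N + 1) : Ω ≃o Ω) α ≤ x
  · obtain ⟨x, hx, hle⟩ := hcase
    refine hfin d₃ (N + 1) h3e.pos_left hd₃ fun γ hγ => ⟨?_, ?_⟩
    · exact hle.trans_lt (h23.lt htrans hx hγ)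
    · exact (h3e.lt htrans hγ hcδ).trans hN2
  · push Not at hcase
    exact hfin d₂ N h23.pos_left hd₂ fun γ hγ =>
      ⟨hN.trans_lt (h12.lt htrans hδ hγ), hcase γ hγ⟩

end Room

/-! ### Embedding into the reals -/

section Embedding

theorem exists_strictMono_real {X : Type*} [LinearOrder X] [DenselyOrdered X] [NoMinOrder X]
    [NoMaxOrder X] [Nonempty X] {P : Set X} (hP : P.Countable)
    (hdense : ∀ x y, x < y → ∃ p ∈ P, x < p ∧ p < y) :
    ∃ j : X → ℝ, StrictMono j ∧ j '' P = Set.range ((↑) : ℚ → ℝ) := by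
  have : Countable P := hP
  have hlow : ∀ x, ∃ p ∈ P, p < x := fun x => by
    obtain ⟨y, hy⟩ := exists_lt x
    obtain ⟨p, hp, -, h⟩ := hdense y x hy
    exact ⟨p, hp, h⟩
  have hhigh : ∀ x, ∃ p ∈ P, x < p := fun x => by
    obtain ⟨y, hy⟩ := exists_gt x
    obtain ⟨p, hp, h, -⟩ := hdense x y hy
    exact ⟨p, hp, h⟩
  have : Nonempty P := by
    obtain ⟨p, hp, -⟩ := hlow (Classical.arbitrary X)
    exact ⟨⟨p, hp⟩⟩
  have : DenselyOrdered P := ⟨fun x y hxy => by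
    obtain ⟨p, hp, h1, h2⟩ := hdense x y hxy
    exact ⟨⟨p, hp⟩, h1, h2⟩⟩
  have : NoMinOrder P := ⟨fun x => by
    obtain ⟨p, hp, h⟩ := hlow x
    exact ⟨⟨p, hp⟩, h⟩⟩
  have : NoMaxOrder P := ⟨fun x => by
    obtain ⟨p, hp, h⟩ := hhigh x
    exact ⟨⟨p, hp⟩, h⟩⟩
  obtain ⟨ι⟩ := Order.iso_of_countable_dense P ℚ
  let S (x : X) : Set ℝ := (fun p => (ι p : ℝ)) '' {p : P | (p : X) ≤ x}
  have hmono : StrictMono fun p : P => (ι p : ℝ) := Rat.cast_strictMono.comp ι.strictMono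
  have hub : ∀ (x : X) (p : P), x ≤ p → (ι p : ℝ) ∈ upperBounds (S x) := by
    rintro x p hx _ ⟨q, hq, rfl⟩
    exact hmono.monotone (show (q : X) ≤ p from hq.trans hx)
  have hmem : ∀ (x : X) (p : P), (p : X) ≤ x → (ι p : ℝ) ∈ S x := fun x p hp => ⟨p, hp, rfl⟩
  refine ⟨fun x => sSup (S x), fun x y hxy => ?_, ?_⟩
  · obtain ⟨p, hp, h1, h2⟩ := hdense x y hxy
    obtain ⟨q, hq, h3, h4⟩ := hdense p y h2
    obtain ⟨l, hl, h5⟩ := hlow x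
    obtain ⟨u, hu, h6⟩ := hhigh y
    calc sSup (S x) ≤ ι ⟨p, hp⟩ := csSup_le ⟨_, hmem x ⟨l, hl⟩ h5.le⟩ (hub x ⟨p, hp⟩ h1.le)
      _ < ι ⟨q, hq⟩ := hmono (show (⟨p, hp⟩ : P) < ⟨q, hq⟩ from h3)
      _ ≤ sSup (S y) := le_csSup ⟨_, hub y ⟨u, hu⟩ h6.le⟩ (hmem y ⟨q, hq⟩ h4.le)
  · have hval : ∀ p : P, sSup (S p) = ι p := fun p =>
      IsGreatest.csSup_eq ⟨hmem p p le_rfl, hub p p le_rfl⟩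
    ext y
    constructor
    · rintro ⟨p, hp, rfl⟩
      exact ⟨ι ⟨p, hp⟩, (hval ⟨p, hp⟩).symm⟩
    · rintro ⟨q, rfl⟩
      refine ⟨ι.symm q, (ι.symm q).2, ?_⟩
      simp [hval]

theorem surjective_of_image_eq_range_cast {f : ℝ → ℝ} (hf : StrictMono f) {D : Set ℝ}
    (hD : f '' D = Set.range ((↑) : ℚ → ℝ)) : Function.Surjective f := by
  have hq : ∀ q : ℚ, ∃ x, f x = q := fun q => by
    obtain ⟨x, -, hx⟩ : (q : ℝ) ∈ f '' D := hD ▸ ⟨q, rfl⟩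
    exact ⟨x, hx⟩
  have hcont : Continuous f := by
    refine hf.monotone.continuous_of_denseRange ?_
    refine Rat.denseRange_cast.mono ?_
    rintro _ ⟨q, rfl⟩
    exact hq q
  refine hcont.surjective (Filter.tendsto_atTop_atTop_of_monotone hf.monotone fun b => ?_)
    (Filter.tendsto_atBot_atBot_of_monotone hf.monotone fun b => ?_)
  · obtain ⟨q, hq'⟩ := exists_rat_gt b
    obtain ⟨x, hx⟩ := hq q
    exact ⟨x, hx ▸ hq'.le⟩
  · obtain ⟨q, hq'⟩ := exists_rat_lt b
    obtain ⟨x, hx⟩ := hq q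
    exact ⟨x, hx ▸ hq'.le⟩

theorem nonempty_orderIso_irrational {j : Ω → ℝ} (hj : StrictMono j) {D : Set ℝ}
    (hD : D.Countable) (hdense : ∀ x y : ℝ, x < y → ∃ p ∈ D, x < p ∧ p < y)
    (hrange : Set.range j = Dᶜ) : Nonempty (Ω ≃o {x : ℝ // Irrational x}) := by
  obtain ⟨f, hf, hfD⟩ := exists_strictMono_real hD hdense
  have hsurj := surjective_of_image_eq_range_cast hf hfD
  have hrange' : Set.range (f ∘ j) = {x | Irrational x} := by
    rw [Set.range_comp, hrange, Set.image_compl_eq ⟨hf.injective, hsurj⟩, hfD]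
    rfl
  exact ⟨((hf.comp hj).orderIso).trans (OrderIso.setCongr _ _ hrange')⟩

theorem isLUB_image_iff {j : Ω → ℝ} (hj : StrictMono j)
    (hjq : ∀ q : ℚ, ∃ p, j p = q) {A : Set Ω} {α : Ω} : IsLUB (j '' A) (j α) ↔ IsLUB A α := by
  constructor
  · rintro ⟨h1, h2⟩
    refine ⟨fun a ha => hj.le_iff_le.1 (h1 ⟨a, ha, rfl⟩), fun γ hγ => hj.le_iff_le.1 (h2 ?_)⟩
    rintro _ ⟨a, ha, rfl⟩
    exact hj.monotone (hγ ha)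
  · rintro ⟨h1, h2⟩
    constructor
    · rintro _ ⟨a, ha, rfl⟩
      exact hj.monotone (h1 ha)
    · intro z hz
      by_contra! hlt
      obtain ⟨q, hq1, hq2⟩ := exists_rat_btwn hlt
      obtain ⟨p, hp⟩ := hjq q
      rw [← hp] at hq1 hq2
      exact (hj.lt_iff_lt.1 hq2).not_ge (h2 fun a ha =>
        hj.le_iff_le.1 ((hz ⟨a, ha, rfl⟩).trans hq1.le))

theorem upperBounds_image_eq {j : Ω → ℝ} (hj : StrictMono j)
    (hjq : ∀ q : ℚ, ∃ p, j p = q) {A B : Set Ω} (h : upperBounds A = upperBounds B) :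
    upperBounds (j '' A) = upperBounds (j '' B) := by
  have key : ∀ {A B : Set Ω}, upperBounds A = upperBounds B →
      upperBounds (j '' A) ⊆ upperBounds (j '' B) := by
    rintro A B h z hz _ ⟨b, hb, rfl⟩
    by_contra! hlt
    obtain ⟨q, hq1, hq2⟩ := exists_rat_btwn hlt
    obtain ⟨p, hp⟩ := hjq q
    rw [← hp] at hq1 hq2
    have h1 : p ∈ upperBounds A := fun a ha => hj.le_iff_le.1 ((hz ⟨a, ha, rfl⟩).trans hq1.le)
    rw [h] at h1
    exact (hj.lt_iff_lt.1 hq2).not_ge (h1 hb)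
  exact (key h).antisymm (key h.symm)

theorem exists_isLUB_supp [NoMaxOrder Ω] {j : Ω → ℝ} (hj : StrictMono j)
    (hjq : ∀ q : ℚ, ∃ p, j p = q)
    (hloc : ∀ α β : Ω, α < β → ∃ d : Ω ≃o Ω, Pos d ∧ d ≠ 1 ∧ supp d ⊆ Set.Ioo α β) (y : ℝ) :
    ∃ s : Ω ≃o Ω, Bdd s ∧ IsLUB (j '' supp s) y := by
  obtain ⟨u, hu, huy, hlim⟩ := Real.exists_seq_rat_strictMono_tendsto y
  choose p hp using fun n => hjq (u n)
  have hpmono : StrictMono p := fun m n hmn => hj.lt_iff_lt.1 (by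
    rw [hp, hp]
    exact Rat.cast_lt.2 (hu hmn))
  choose d hd hd1 hdsub using fun n => hloc (p n) (p (n + 1)) (hpmono n.lt_succ_self)
  have hdisj : ∀ m n, m < n → ∀ α ∈ supp (d m), α ∉ supp (d n) := fun m n hmn α h1 h2 =>
    lt_irrefl _ ((hdsub m h1).2.trans_le ((hpmono.monotone hmn).trans (hdsub n h2).1.le))
  obtain ⟨s, hs1, hs2⟩ := exists_glue (Set.range d) (by
    rintro _ ⟨m, rfl⟩ _ ⟨n, rfl⟩ α h1 h2
    rcases lt_trichotomy m n with h | h | h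
    · exact absurd h2 (hdisj m n h α h1)
    · rw [h]
    · exact absurd h1 (hdisj n m h α h2))
  simp only [Set.forall_mem_range] at hs1 hs2
  have hsupp : ∀ α, α ∈ supp s ↔ ∃ n, α ∈ supp (d n) := by
    intro α
    constructor
    · intro h
      by_contra! hcon
      exact h (hs2 α hcon)
    · rintro ⟨n, hn⟩
      change s α ≠ α
      rw [hs1 n α hn]
      exact hn
  have hpos : Pos s := pos_iff.2 fun α => by
    by_cases h : ∃ n, α ∈ supp (d n)
    · obtain ⟨n, hn⟩ := h
      rw [hs1 n α hn]
      exact pos_iff.1 (hd n) α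
    · push Not at h
      rw [hs2 α h]
  have hlub : IsLUB (j '' supp s) y := by
    constructor
    · rintro _ ⟨α, hα, rfl⟩
      obtain ⟨n, hn⟩ := (hsupp α).1 hα
      have := hj (hdsub n hn).2
      rw [hp] at this
      exact (this.trans (huy _)).le
    · intro z hz
      refine le_of_tendsto' hlim fun n => ?_
      obtain ⟨α, hα⟩ := ne_one_iff.1 (hd1 n)
      have := hj (hdsub n hα).1
      rw [hp] at this
      exact this.le.trans (hz ⟨α, (hsupp α).2 ⟨n, hα⟩, rfl⟩)
  refine ⟨s, ⟨hpos, ?_, ?_⟩, hlub⟩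
  · obtain ⟨α, hα⟩ := ne_one_iff.1 (hd1 0)
    exact ne_one_iff.2 ⟨α, (hsupp α).2 ⟨0, hα⟩⟩
  · obtain ⟨q, hq⟩ := exists_rat_gt y
    obtain ⟨r, hr⟩ := hjq q
    obtain ⟨r', hr'⟩ := exists_gt r
    obtain ⟨e, he, he1, hsub⟩ := hloc r r' hr'
    refine ⟨e, he1, leftOf_of_forall hpos he fun σ hσ δ hδ => ?_⟩
    have h1 : j σ < j r := (hlub.1 ⟨σ, hσ, rfl⟩).trans_lt (hr ▸ hq)
    exact (hj.lt_iff_lt.1 h1).trans (hsub hδ).1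

end Embedding

section Dichotomy

theorem upperBounds_eq_of_sameSup (htrans : ∀ α β : Ω, ∃ g : Ω ≃o Ω, g α = β)
    (hloc : ∀ α β : Ω, α < β → ∃ d : Ω ≃o Ω, Pos d ∧ d ≠ 1 ∧ supp d ⊆ Set.Ioo α β)
    {s t : Ω ≃o Ω} (hs : Pos s) (ht : Pos t) (h : SameSup s t) :
    upperBounds (supp s) = upperBounds (supp t) := by
  have key : ∀ {s t : Ω ≃o Ω}, Pos s → Pos t → SameSup s t →
      upperBounds (supp s) ⊆ upperBounds (supp t) := by
    intro s t hs ht h β hβ τ hτ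
    by_contra! hlt
    obtain ⟨d, hd, hd1, hsub⟩ := hloc β τ hlt
    have h1 : LeftOf s d := (leftOf_iff htrans hs hd).2 fun γ hγ σ hσ =>
      (hβ hσ).trans (hsub hγ).1.le
    obtain ⟨γ, hγ⟩ := ne_one_iff.1 hd1
    exact lt_asymm (((h d hd).1 h1).lt htrans hτ hγ) (hsub hγ).2
  exact (key hs ht h).antisymm (key ht hs fun d hd => (h d hd).symm)

theorem IsBaseFamily.exists_supp_subset {g k : Ω ≃o Ω}
    (hloc : ∀ α β : Ω, α < β → ∃ d : Ω ≃o Ω, Pos d ∧ d ≠ 1 ∧ supp d ⊆ Set.Ioo α β)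
    (hbase : IsBaseFamily g k) {α β : Ω} (hαβ : α < β) :
    ∃ a, Mem g k a ∧ supp a ⊆ Set.Icc α β := by
  obtain ⟨c, hc, hc1, hcsub⟩ := hloc α β hαβ
  obtain ⟨a, ha, hac⟩ := hbase c hc hc1
  have key : ∀ γ δ, γ < δ → δ ≤ a γ → (δ ≤ α ∨ β ≤ γ) → False := by
    intro γ δ hγδ hδ hout
    obtain ⟨x, hx, hx1, hxsub⟩ := hloc γ δ hγδ
    have h1 : Disj x c := disj_iff.2 ⟨hx, hc, fun τ => by
      by_contra! hτ
      have h2 := hxsub hτ.1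
      have h3 := hcsub hτ.2
      rcases hout with h | h
      · exact lt_asymm (h2.2.trans_le h) h3.1
      · exact lt_asymm (h3.2.trans_le h) h2.1⟩
    obtain ⟨τ, hτ⟩ := ne_one_iff.1 hx1
    rcases (disj_iff.1 (hac x h1)).2.2 τ with h | h
    · exact hτ h
    · exact Ioo_subset_supp ⟨(hxsub hτ).1, (hxsub hτ).2.trans_le hδ⟩ h
  refine ⟨a, ha, fun γ hγ => ⟨?_, ?_⟩⟩
  · by_contra! hlt
    exact key γ (min (a γ) α) (lt_min (ha.irr.1.lt hγ) hlt) (min_le_left _ _)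
      (Or.inl (min_le_right _ _))
  · by_contra! hlt
    exact key γ (a γ) (ha.irr.1.lt hγ) le_rfl (Or.inr hlt.le)

theorem RatLike.orderIso (htrans : ∀ α β : Ω, ∃ g : Ω ≃o Ω, g α = β) (h : RatLike Ω) :
    Nonempty (Ω ≃o ℚ) ∨ Nonempty (Ω ≃o {x : ℝ // Irrational x}) := by
  obtain ⟨hroom, g, g', k, hk, hbase, hinv, hco⟩ := h
  obtain ⟨o, ho⟩ := ne_one_iff.1 hk.2.1
  have ho := hk.1.lt ho
  have : Nonempty Ω := ⟨o⟩
  have : NoMaxOrder Ω := ⟨fun β => by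
    obtain ⟨f, rfl⟩ := htrans o β
    exact ⟨_, f.strictMono ho⟩⟩
  have : NoMinOrder Ω := ⟨fun β => by
    obtain ⟨f, rfl⟩ := htrans (k o) β
    exact ⟨_, f.strictMono ho⟩⟩
  have hloc : ∀ α β : Ω, α < β → ∃ d : Ω ≃o Ω, Pos d ∧ d ≠ 1 ∧ supp d ⊆ Set.Ioo α β :=
    fun α β hαβ => exists_supp_subset_Ioo htrans hroom hαβ
  have : DenselyOrdered Ω := ⟨fun α β hαβ => by
    obtain ⟨d, -, hd, hsub⟩ := hloc α β hαβ
    obtain ⟨γ, hγ⟩ := ne_one_iff.1 hd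
    exact ⟨γ, hsub hγ⟩⟩
  have hcount : {a | Mem g k a}.Countable := countable_mem hk
  have hne : ∀ a, Mem g k a → (supp a).Nonempty := fun a ha => ne_one_iff.1 ha.irr.2.1
  obtain ⟨j, hj, hjP⟩ : ∃ j : Ω → ℝ, StrictMono j ∧ ∀ q : ℚ, ∃ p, j p = q := by
    have : Countable {a | Mem g k a} := hcount
    choose pt hpt using fun a : {a | Mem g k a} => hne a.1 a.2
    obtain ⟨j, hj, hjP⟩ := exists_strictMono_real (Set.countable_range pt) fun x y hxy => by
      obtain ⟨x', hx, h2⟩ := exists_between hxy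
      obtain ⟨y', h1, hy⟩ := exists_between h2
      obtain ⟨a, ha, hsub⟩ := hbase.exists_supp_subset hloc h1
      have := hsub (hpt ⟨a, ha⟩)
      exact ⟨_, ⟨⟨a, ha⟩, rfl⟩, hx.trans_le this.1, this.2.trans_lt hy⟩
    refine ⟨j, hj, fun q => ?_⟩
    obtain ⟨p, -, hp⟩ : (q : ℝ) ∈ j '' Set.range pt := hjP ▸ ⟨q, rfl⟩
    exact ⟨p, hp⟩
  let D : Set ℝ := {y | ∃ a, Mem g k a ∧ IsLUB (j '' supp a) y}
  have hDcount : D.Countable := by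
    refine (hcount.image fun a => sSup (j '' supp a)).mono ?_
    rintro y ⟨a, ha, hy⟩
    exact ⟨a, ha, hy.csSup_eq ((hne a ha).image j)⟩
  have hlub_iff : ∀ {s t : Ω ≃o Ω} {y : ℝ}, Pos s → Pos t → SameSup s t →
      IsLUB (j '' supp s) y → IsLUB (j '' supp t) y := by
    intro s t y hs ht hst hy
    have := upperBounds_image_eq hj hjP (upperBounds_eq_of_sameSup htrans hloc hs ht hst)
    rwa [IsLUB, ← this]
  have hmemD : ∀ {s : Ω ≃o Ω} {y : ℝ}, Pos s → IsLUB (j '' supp s) y → SupMem g k s → y ∈ D := by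
    rintro s y hs hy ⟨a, ha, hsa⟩
    exact ⟨a, ha, hlub_iff hs ha.irr.1 hsa hy⟩
  have hlubconj : ∀ (s f : Ω ≃o Ω) (α : Ω), IsLUB (j '' supp s) (j α) →
      IsLUB (j '' supp (f * s * f⁻¹)) (j (f α)) := by
    intro s f α h
    rw [isLUB_image_iff hj hjP] at h ⊢
    rw [supp_conj]
    exact f.isLUB_image'.2 h
  by_cases hcase : ∃ α, j α ∈ D
  · left
    obtain ⟨α, a, ha, hα⟩ := hcase
    have hall : ∀ β, j β ∈ D := by
      intro β
      obtain ⟨f, rfl⟩ := htrans α β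
      exact hmemD (ha.irr.1.conj f) (hlubconj a f α hα) (hinv a ha f _ rfl)
    have : Countable D := hDcount
    have : Countable Ω := (show Function.Injective fun β => (⟨j β, hall β⟩ : D) from
      fun β γ h => hj.injective (congrArg Subtype.val h)).countable
    exact Order.iso_of_countable_dense Ω ℚ
  · right
    push Not at hcase
    refine nonempty_orderIso_irrational hj hDcount (fun x y hxy => ?_) ?_
    · obtain ⟨q, hxq, hqy⟩ := exists_rat_btwn hxy
      obtain ⟨r, hqr, hry⟩ := exists_rat_btwn hqy
      obtain ⟨α, hα⟩ := hjP q
      obtain ⟨β, hβ⟩ := hjP r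
      have hαβ : α < β := hj.lt_iff_lt.1 (by rwa [hα, hβ])
      obtain ⟨a, ha, hsub⟩ := hbase.exists_supp_subset hloc hαβ
      have hbdd : (r : ℝ) ∈ upperBounds (j '' supp a) := by
        rintro _ ⟨γ, hγ, rfl⟩
        exact hβ ▸ hj.monotone (hsub hγ).2
      have hl := isLUB_csSup ((hne a ha).image j) ⟨_, hbdd⟩
      refine ⟨_, ⟨a, ha, hl⟩, ?_, (hl.2 hbdd).trans_lt hry⟩
      obtain ⟨γ, hγ⟩ := hne a ha
      refine hxq.trans_le (le_trans ?_ (hl.1 ⟨γ, hγ, rfl⟩))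
      exact hα ▸ hj.monotone (hsub hγ).1
    · ext y
      constructor
      · rintro ⟨α, rfl⟩
        exact hcase α
      · intro hy
        obtain ⟨s, hs, hsy⟩ := exists_isLUB_supp hj hjP hloc (j o)
        obtain ⟨t, ht, hty⟩ := exists_isLUB_supp hj hjP hloc y
        obtain ⟨f, e, rfl, hfe⟩ := hco s t hs ht (fun h => hcase o (hmemD hs.1 hsy h))
          (fun h => hy (hmemD ht.1 hty h))
        exact ⟨f o, (hlub_iff (hs.1.conj f) ht.1 hfe (hlubconj s f o hsy)).unique hty⟩

end Dichotomy

/-! ### Automorphisms of the rationals -/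

section Bumps

theorem irrComm_one_of_reach {a : Ω ≃o Ω} (hpos : Pos a) (hne : a ≠ 1)
    (hreach : ∀ C ⊆ supp a, (∀ τ ∈ C, Set.Icc τ (a τ) ⊆ C) →
      ∀ t ∈ C, ∀ s ∈ supp a, t ≤ s → s ∈ C) : IrrComm 1 a := by
  refine ⟨hpos, hne, by simp, fun x hx _ => ?_⟩
  have hxa := (comp_iff hpos).1 hx
  have hsupp : ∀ {τ τ'}, τ ∈ supp a → τ' ∈ Set.Icc τ (a τ) → τ' ∈ supp a := by
    intro τ τ' hτ hτ' hfix
    rcases hτ'.1.eq_or_lt with h | h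
    · exact hτ (h ▸ hfix)
    · exact hτ (a.injective ((hτ'.2.antisymm (hfix ▸ a.monotone h.le)) ▸ hfix))
  have hE : ∀ τ ∈ {τ ∈ supp a | x τ = a τ}, Set.Icc τ (a τ) ⊆ {τ ∈ supp a | x τ = a τ} := by
    rintro τ ⟨hτ, hxτ⟩ τ' hτ'
    refine ⟨hsupp hτ hτ', (hxa τ').resolve_left fun hfix => ?_⟩
    have h1 : a τ ≤ τ' := by
      rw [← hxτ, ← hfix]
      exact x.monotone hτ'.1
    have h2 : τ' = x τ := (hτ'.2.antisymm h1).trans hxτ.symm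
    rw [h2] at hfix
    exact hτ (hxτ.symm.trans (x.injective hfix))
  have hF : ∀ τ ∈ {τ ∈ supp a | x τ = τ}, Set.Icc τ (a τ) ⊆ {τ ∈ supp a | x τ = τ} := by
    rintro τ ⟨hτ, hxτ⟩ τ' hτ'
    refine ⟨hsupp hτ hτ', (hxa τ').resolve_right fun hmv => ?_⟩
    have h1 : x (a τ) = a τ := by
      have e : x (x⁻¹ (a τ)) = a τ := RelIso.apply_inv_self x _
      rcases hxa (x⁻¹ (a τ)) with h | h
      · rwa [h.symm.trans e] at e
      · have h2 : x⁻¹ (a τ) = τ := a.injective (h.symm.trans e)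
        rw [h2, hxτ] at e
        exact absurd e.symm hτ
    have h2 : a τ' ≤ a τ := by
      rw [← hmv, ← h1]
      exact x.monotone hτ'.2
    have h3 : τ' = τ := (a.le_iff_le.1 h2).antisymm hτ'.1
    rw [h3, hxτ] at hmv
    exact hτ hmv.symm
  by_cases hx1 : x = 1
  · exact Or.inl hx1
  right
  obtain ⟨t, ht⟩ := ne_one_iff.1 hx1
  ext τ
  by_cases hτ : τ ∈ supp a
  · refine (hxa τ).resolve_left fun hfix => ?_
    have hta : t ∈ supp a := hx.supp_subset hpos ht
    have hmax : max t τ ∈ supp a := by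
      rcases max_choice t τ with h | h <;> rw [h] <;> assumption
    have h1 := hreach _ (fun _ h => h.1) hE t ⟨hta, hx.apply_eq hpos ht⟩ _ hmax (le_max_left _ _)
    have h2 := hreach _ (fun _ h => h.1) hF τ ⟨hτ, hfix⟩ _ hmax (le_max_right _ _)
    exact hmax (h1.2.symm.trans h2.2)
  · rw [not_not.1 hτ]
    by_contra h
    exact hτ (hx.supp_subset hpos h)

theorem exists_affine {c : ℚ} (hc : 0 < c) (d : ℚ) : ∃ A : ℚ ≃o ℚ, ∀ x, A x = c * x + d :=
  ⟨(OrderIso.mulLeft₀ c hc).trans (OrderIso.addRight d), fun _ => rfl⟩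

theorem rat_trans (α β : ℚ) : ∃ g : ℚ ≃o ℚ, g α = β := by
  obtain ⟨A, hA⟩ := exists_affine one_pos (β - α)
  exact ⟨A, by rw [hA]; ring⟩

theorem exists_bump {p q : ℚ} (hpq : p < q) :
    ∃ a : ℚ ≃o ℚ, supp a = Set.Ioo p q ∧ IrrComm 1 a := by
  obtain ⟨A, hA⟩ := exists_affine two_pos (-p)
  obtain ⟨B, hB⟩ := exists_affine (half_pos one_pos) (q / 2)
  let a : ℚ ≃o ℚ := autSup 1 (autInf A B)
  have ha : ∀ x, a x = max x (min (2 * x + -p) (1 / 2 * x + q / 2)) := fun x => by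
    rw [← hA, ← hB]
    rfl
  have hpos : Pos a := pos_iff.2 fun x => le_max_left _ _
  have hsupp : supp a = Set.Ioo p q := by
    ext x
    change a x ≠ x ↔ _
    rw [ha, Ne, max_eq_left_iff, not_le, lt_min_iff]
    constructor
    · rintro ⟨h1, h2⟩
      constructor <;> linarith
    · rintro ⟨h1, h2⟩
      constructor <;> linarith
  refine ⟨a, hsupp, irrComm_one_of_reach hpos ?_ ?_⟩
  · rw [ne_one_iff, hsupp]
    exact Set.nonempty_Ioo.2 hpq
  · intro C hC hstep t ht s hs _
    have htp := hC ht
    rw [hsupp] at hs htp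
    obtain ⟨ε, hε, hε1, hε2⟩ : ∃ ε > 0, ε ≤ t - p ∧ ε ≤ (q - s) / 2 :=
      ⟨min (t - p) ((q - s) / 2), lt_min (sub_pos.2 htp.1) (half_pos (sub_pos.2 hs.2)),
        min_le_left _ _, min_le_right _ _⟩
    have key : ∀ n : ℕ, ∀ τ ∈ C, t ≤ τ → τ ≤ s → s ≤ τ + n * ε → s ∈ C := by
      intro n
      induction n with
      | zero =>
        intro τ hτ _ h2 h3
        have : s = τ := le_antisymm (by simpa using h3) h2
        rwa [this]
      | succ n ih =>
        intro τ hτ h1 h2 h3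
        rcases le_or_gt s (a τ) with h | h
        · exact hstep τ hτ ⟨h2, h⟩
        · have haτ : τ + ε ≤ a τ := by
            rw [ha]
            refine le_max_of_le_right (le_min ?_ ?_) <;> linarith
          refine ih (a τ) (hstep τ hτ ⟨pos_iff.1 hpos τ, le_rfl⟩)
            (h1.trans (pos_iff.1 hpos τ)) h.le ?_
          push_cast at h3
          linarith
    obtain ⟨n, hn⟩ := Archimedean.arch (s - t) hε
    rw [nsmul_eq_mul] at hn
    exact key n t ht le_rfl ‹_› (by linarith)

theorem hasRoom_rat : HasRoom ℚ := by
  intro h hh h1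
  obtain ⟨x, hx⟩ := ne_one_iff.1 h1
  have hx := hh.lt hx
  obtain ⟨y, hxy, hyh⟩ := exists_between hx
  obtain ⟨z, hyz, hzh⟩ := exists_between hyh
  obtain ⟨d₁, hd₁, hi₁⟩ := exists_bump hxy
  obtain ⟨d₂, hd₂, hi₂⟩ := exists_bump hyz
  obtain ⟨d₃, hd₃, hi₃⟩ := exists_bump hzh
  refine ⟨d₁, d₂, d₃, hi₁.2.1, hi₂.2.1, hi₃.2.1, leftOf_of_forall hi₁.1 hi₂.1 ?_,
    leftOf_of_forall hi₂.1 hi₃.1 ?_, _, rfl, leftOf_of_forall hi₃.1 (hi₁.1.conj h) ?_⟩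
  · rw [hd₁, hd₂]
    exact fun σ hσ δ hδ => hσ.2.trans hδ.1
  · rw [hd₂, hd₃]
    exact fun σ hσ δ hδ => hσ.2.trans hδ.1
  · rw [hd₃, supp_conj, hd₁, h.image_Ioo]
    exact fun σ hσ δ hδ => hσ.2.trans hδ.1

theorem exists_interpolation {w : ℤ → ℚ} (hw : StrictMono w) (hlow : ∀ y, ∃ m, w m ≤ y)
    (hhigh : ∀ y, ∃ m, y < w m) : ∃ φ : ℚ ≃o ℚ, ∀ m : ℤ, φ m = w m := by
  let F (x : ℚ) : ℚ := w ⌊x⌋ + Int.fract x * (w (⌊x⌋ + 1) - w ⌊x⌋)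
  have hstep : ∀ m, 0 < w (m + 1) - w m := fun m => sub_pos.2 (hw (lt_add_one m))
  have hmono : StrictMono F := by
    intro x y hxy
    rcases (Int.floor_mono hxy.le).eq_or_lt with h | h
    · have h1 : Int.fract x < Int.fract y := by
        rw [Int.fract, Int.fract, h]
        exact sub_lt_sub_right hxy _
      have := mul_lt_mul_of_pos_right h1 (hstep ⌊y⌋)
      simp only [F, h]
      linarith
    · have h1 : F x < w (⌊x⌋ + 1) := by
        have := mul_lt_mul_of_pos_right (Int.fract_lt_one x) (hstep ⌊x⌋)
        simp only [F]
        linarith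
      have h2 : w ⌊y⌋ ≤ F y :=
        le_add_of_nonneg_right (mul_nonneg (Int.fract_nonneg y) (hstep _).le)
      exact h1.trans_le ((hw.monotone h).trans h2)
  have hsurj : Function.Surjective F := by
    intro y
    obtain ⟨m, hm, hmax⟩ := Int.exists_greatest_of_bdd (P := fun m => w m ≤ y)
      (by
        obtain ⟨n, hn⟩ := hhigh y
        exact ⟨n, fun z hz => (hw.lt_iff_lt.1 (hz.trans_lt hn)).le⟩) (hlow y)
    have hm1 : y < w (m + 1) := by
      by_contra! hcon
      exact absurd (hmax _ hcon) (by omega)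
    have hr0 : 0 ≤ (y - w m) / (w (m + 1) - w m) := div_nonneg (sub_nonneg.2 hm) (hstep m).le
    have hr1 : (y - w m) / (w (m + 1) - w m) < 1 := by
      rw [div_lt_one (hstep m)]
      exact sub_lt_sub_right hm1 _
    refine ⟨m + (y - w m) / (w (m + 1) - w m), ?_⟩
    have hfl : ⌊(m : ℚ) + (y - w m) / (w (m + 1) - w m)⌋ = m := by
      rw [Int.floor_intCast_add, Int.floor_eq_zero_iff.2 ⟨hr0, hr1⟩, add_zero]
    have hfr : Int.fract ((m : ℚ) + (y - w m) / (w (m + 1) - w m)) =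
        (y - w m) / (w (m + 1) - w m) := by
      rw [Int.fract_intCast_add, Int.fract_eq_self.2 ⟨hr0, hr1⟩]
    simp only [F, hfl, hfr]
    rw [div_mul_cancel₀ _ (hstep m).ne', add_sub_cancel]
  refine ⟨hmono.orderIsoOfSurjective _ hsurj, fun m => ?_⟩
  change F m = w m
  simp [F]

theorem zpow_apply_eq {g : Ω ≃o Ω} {f : ℤ → Ω} (h : ∀ m, g (f m) = f (m + 1)) (n m : ℤ) :
    (g ^ n : Ω ≃o Ω) (f m) = f (m + n) := by
  induction n with
  | zero => simp
  | succ n ih =>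
    rw [add_comm (n : ℤ) 1, zpow_one_add, RelIso.mul_apply, ih, h]
    congr 1
    ring
  | pred n ih =>
    rw [sub_eq_add_neg, add_comm, zpow_add, zpow_neg_one, RelIso.mul_apply, ih,
      apply_inv_eq_iff, h]
    congr 1
    ring

theorem exists_shift : ∃ (g' : ℚ ≃o ℚ) (u v : ℤ → ℚ), (∀ n, g' (u n) = u (n + 1)) ∧
    (∀ n, g' (v n) = v (n + 1)) ∧ (∀ n : ℤ, n < u n ∧ u n < v n ∧ v n ≤ n + 1) ∧
    ∀ p q : ℚ, 0 < p → p < q → q ≤ 1 → ∃ n : ℤ, u n = n + p ∧ v n = n + q := by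
  let T : Set (ℚ × ℚ) := {r | 0 < r.1 ∧ r.1 < r.2 ∧ r.2 ≤ 1}
  have : Nonempty T := ⟨⟨(1 / 2, 1), by norm_num [T]⟩⟩
  obtain ⟨e, he⟩ := exists_surjective_nat T
  let p (n : ℤ) : ℚ := (e n.natAbs).1.1
  let q (n : ℤ) : ℚ := (e n.natAbs).1.2
  have hp : ∀ n, 0 < p n := fun n => (e n.natAbs).2.1
  have hpq : ∀ n, p n < q n := fun n => (e n.natAbs).2.2.1
  have hq : ∀ n, q n ≤ 1 := fun n => (e n.natAbs).2.2.2
  let w (m : ℤ) : ℚ := (m / 2 : ℤ) + if m % 2 = 0 then p (m / 2) else q (m / 2)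
  have hw0 : ∀ n : ℤ, w (2 * n) = n + p n := fun n => by
    have h1 : 2 * n / 2 = n := by omega
    have h2 : 2 * n % 2 = 0 := by omega
    simp only [w, h1, h2, if_true]
  have hw1 : ∀ n : ℤ, w (2 * n + 1) = n + q n := fun n => by
    have h1 : (2 * n + 1) / 2 = n := by omega
    have h2 : (2 * n + 1) % 2 = 1 := by omega
    simp only [w, h1, h2, one_ne_zero, if_false]
  have hw : StrictMono w := by
    refine strictMono_int_of_lt_succ fun m => ?_
    obtain ⟨n, rfl | rfl⟩ := Int.even_or_odd' m
    · rw [hw0, hw1]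
      linarith [hpq n]
    · have e : 2 * n + 1 + 1 = 2 * (n + 1) := by ring
      rw [e, hw0, hw1]
      push_cast
      linarith [hq n, hp (n + 1)]
  obtain ⟨φ, hφ⟩ := exists_interpolation hw
    (fun y => ⟨2 * (⌊y⌋ - 1), by
      rw [hw0]
      push_cast
      linarith [hpq (⌊y⌋ - 1), hq (⌊y⌋ - 1), Int.floor_le y]⟩)
    (fun y => ⟨2 * ⌈y⌉, by
      rw [hw0]
      linarith [hp ⌈y⌉, Int.le_ceil y]⟩)
  obtain ⟨A, hA⟩ := exists_affine one_pos 2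
  have hshift : ∀ m, (φ * A * φ⁻¹) (w m) = w (m + 2) := fun m => by
    rw [conj_apply, ← hφ, RelIso.inv_apply_self, hA, ← hφ]
    push_cast
    rw [one_mul]
  refine ⟨φ * A * φ⁻¹, fun n => w (2 * n), fun n => w (2 * n + 1), fun n => ?_, fun n => ?_,
    fun n => ?_, fun p' q' h1 h2 h3 => ?_⟩
  · beta_reduce
    rw [hshift, mul_add, mul_one]
  · beta_reduce
    rw [hshift]
    congr 1
    ring
  · beta_reduce
    rw [hw0, hw1]
    have := hp n
    have := hpq n
    have := hq n
    refine ⟨?_, ?_, ?_⟩ <;> linarith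
  · obtain ⟨n, hn⟩ := he ⟨(p', q'), h1, h2, h3⟩
    refine ⟨n, ?_, ?_⟩ <;> beta_reduce
    · rw [hw0]
      simp [p, hn]
    · rw [hw1]
      simp [q, hn]

end Bumps

section Rationals

theorem exists_irrComm_glue {g a : ℚ ≃o ℚ} (ha : IrrComm 1 a) {c : ℤ}
    (h : ∀ n, supp (zconj g a n) ⊆ Set.Ioo ((c + n : ℤ) : ℚ) ((c + n + 1 : ℤ) : ℚ)) :
    ∃ F, IrrComm g F ∧ ∀ n, Atom (zconj g a n) F := by
  have hlt : ∀ m n, m < n → ∀ α ∈ supp (zconj g a m), α ∉ supp (zconj g a n) := by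
    intro m n hmn α h1 h2
    have h3 : c + n < c + m + 1 := Int.cast_lt.1 ((h n h2).1.trans (h m h1).2)
    omega
  obtain ⟨F, hF1, hF2⟩ := exists_glue (Set.range (zconj g a)) (by
    rintro _ ⟨m, rfl⟩ _ ⟨n, rfl⟩ α h1 h2
    rcases lt_trichotomy m n with h | h | h
    · exact absurd h2 (hlt m n h α h1)
    · rw [h]
    · exact absurd h1 (hlt n m h α h2))
  simp only [Set.forall_mem_range] at hF1 hF2
  exact ⟨F, irrComm_of_glue ha hF1 hF2⟩

theorem sameSup_of_isLUB (htrans : ∀ α β : Ω, ∃ g : Ω ≃o Ω, g α = β) {s t : Ω ≃o Ω} {α : Ω}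
    (hs : Pos s) (ht : Pos t) (h1 : IsLUB (supp s) α) (h2 : IsLUB (supp t) α) :
    SameSup s t :=
  sameSup_of_upperBounds_eq htrans hs ht (h1.upperBounds_eq.trans h2.upperBounds_eq.symm)

/-- `U` is the upper part of a cut of the rationals which is not filled. -/
def IsGap (U : Set ℚ) : Prop :=
  IsUpperSet U ∧ U.Nonempty ∧ Uᶜ.Nonempty ∧ (∀ x ∈ U, ∃ y ∈ U, y < x) ∧ ∀ x ∉ U, ∃ y ∉ U, x < y

theorem IsGap.nonempty_orderIso {U V : Set ℚ} (hU : IsGap U) (hV : IsGap V) :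
    Nonempty (U ≃o V) ∧ Nonempty ((Uᶜ : Set ℚ) ≃o (Vᶜ : Set ℚ)) := by
  have key : ∀ {U : Set ℚ}, IsGap U → Nonempty (U ≃o ℚ) ∧ Nonempty ((Uᶜ : Set ℚ) ≃o ℚ) := by
    intro U ⟨hup, hne, hne', hmin, hmax⟩
    have := hne.to_subtype
    have := hne'.to_subtype
    have : U.OrdConnected := hup.ordConnected
    have : Uᶜ.OrdConnected := hup.compl.ordConnected
    have : NoMinOrder U := ⟨fun x => by
      obtain ⟨y, hy, h⟩ := hmin x x.2
      exact ⟨⟨y, hy⟩, h⟩⟩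
    have : NoMaxOrder U := ⟨fun x => ⟨⟨x + 1, hup (by simp) x.2⟩, by
      rw [← Subtype.coe_lt_coe]; simp⟩⟩
    have : NoMaxOrder (Uᶜ : Set ℚ) := ⟨fun x => by
      obtain ⟨y, hy, h⟩ := hmax x x.2
      exact ⟨⟨y, hy⟩, h⟩⟩
    have : NoMinOrder (Uᶜ : Set ℚ) := ⟨fun x => ⟨⟨x - 1, hup.compl (by simp) x.2⟩, by
      rw [← Subtype.coe_lt_coe]; simp⟩⟩
    exact ⟨Order.iso_of_countable_dense _ _, Order.iso_of_countable_dense _ _⟩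
  obtain ⟨⟨e₁⟩, ⟨e₂⟩⟩ := key hU
  obtain ⟨⟨e₃⟩, ⟨e₄⟩⟩ := key hV
  exact ⟨⟨e₁.trans e₃.symm⟩, ⟨e₂.trans e₄.symm⟩⟩

theorem IsGap.exists_image_eq {U V : Set ℚ} (hU : IsGap U) (hV : IsGap V) :
    ∃ f : ℚ ≃o ℚ, f '' U = V := by
  classical
  obtain ⟨⟨e⟩, ⟨e'⟩⟩ := hU.nonempty_orderIso hV
  let F (x : ℚ) : ℚ := if h : x ∈ U then e ⟨x, h⟩ else e' ⟨x, h⟩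
  have hF1 : ∀ x (h : x ∈ U), F x = e ⟨x, h⟩ := fun x h => dif_pos h
  have hF2 : ∀ x (h : x ∉ U), F x = e' ⟨x, h⟩ := fun x h => dif_neg h
  have hmono : StrictMono F := by
    intro x y hxy
    by_cases hx : x ∈ U <;> by_cases hy : y ∈ U
    · rw [hF1 x hx, hF1 y hy]
      exact e.strictMono (show (⟨x, hx⟩ : U) < ⟨y, hy⟩ from hxy)
    · exact absurd (hU.1 hxy.le hx) hy
    · rw [hF2 x hx, hF1 y hy]
      by_contra! hle
      exact (e' ⟨x, hx⟩).2 (hV.1 hle (e ⟨y, hy⟩).2)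
    · rw [hF2 x hx, hF2 y hy]
      exact e'.strictMono (show (⟨x, hx⟩ : (Uᶜ : Set ℚ)) < ⟨y, hy⟩ from hxy)
  have hpre : ∀ y (h : y ∈ V), F (e.symm ⟨y, h⟩) = y := fun y h => by
    rw [hF1 _ (e.symm ⟨y, h⟩).2]
    simp
  have hsurj : Function.Surjective F := by
    intro y
    by_cases hy : y ∈ V
    · exact ⟨_, hpre y hy⟩
    · refine ⟨e'.symm ⟨y, hy⟩, ?_⟩
      rw [hF2 _ (e'.symm ⟨y, hy⟩).2]
      simp
  refine ⟨hmono.orderIsoOfSurjective _ hsurj, ?_⟩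
  ext y
  constructor
  · rintro ⟨x, hx, rfl⟩
    change F x ∈ V
    rw [hF1 x hx]
    exact (e ⟨x, hx⟩).2
  · intro hy
    exact ⟨_, (e.symm ⟨y, hy⟩).2, hpre y hy⟩

theorem Bdd.isGap {s : ℚ ≃o ℚ} (hs : Bdd s) (h : ∀ q, ¬ IsLUB (supp s) q) :
    IsGap (upperBounds (supp s)) := by
  obtain ⟨hpos, hne, d, hd, hsd⟩ := hs
  have hmax : ∀ σ ∈ supp s, σ ∉ upperBounds (supp s) := fun σ hσ hub =>
    (hpos.lt hσ).not_ge (hub (apply_mem_supp.2 hσ))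
  refine ⟨fun x y hxy hx σ hσ => (hx hσ).trans hxy, ?_, ?_, fun x hx => ?_, fun x hx => ?_⟩
  · obtain ⟨δ, hδ⟩ := ne_one_iff.1 hd
    exact ⟨δ, fun σ hσ => (hsd.lt rat_trans hσ hδ).le⟩
  · obtain ⟨σ, hσ⟩ := ne_one_iff.1 hne
    exact ⟨σ, hmax σ hσ⟩
  · by_contra! hcon
    exact h x ⟨hx, hcon⟩
  · rw [mem_upperBounds] at hx
    push Not at hx
    obtain ⟨σ, hσ, hlt⟩ := hx
    exact ⟨σ, hmax σ hσ, hlt⟩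

theorem ratLike_of_intervals {g g' k : ℚ ≃o ℚ} (hk : IrrComm g' k)
    (hlub : ∀ a, Mem g k a → ∃ q, IsLUB (supp a) q)
    (hex : ∀ p q : ℚ, p < q → ∃ a, Mem g k a ∧ supp a ⊆ Set.Ioo p q ∧ IsLUB (supp a) q) :
    RatLike ℚ := by
  have hsup : ∀ (s : ℚ ≃o ℚ) q, Pos s → IsLUB (supp s) q → SupMem g k s := by
    intro s q hs hq
    obtain ⟨a, ha, -, haq⟩ := hex (q - 1) q (sub_one_lt q)
    exact ⟨a, ha, sameSup_of_isLUB rat_trans hs ha.irr.1 hq haq⟩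
  refine ⟨hasRoom_rat, g, g', k, hk, ?_, ?_, ?_⟩
  · intro c hc hc1
    obtain ⟨x, hx⟩ := ne_one_iff.1 hc1
    obtain ⟨a, ha, hsub, -⟩ := hex x (c x) (hc.lt hx)
    refine ⟨a, ha, fun y hy => ?_⟩
    rw [disj_iff] at hy ⊢
    refine ⟨hy.1, ha.irr.1, fun α => ?_⟩
    by_contra! hcon
    exact (hy.2.2 α).elim hcon.1 (Ioo_subset_supp (hsub hcon.2))
  · rintro a ha f _ rfl
    obtain ⟨q, hq⟩ := hlub a ha
    refine hsup _ (f q) (ha.irr.1.conj f) ?_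
    rw [supp_conj]
    exact f.isLUB_image'.2 hq
  · intro s t hs ht hs' ht'
    obtain ⟨f, hf⟩ := (hs.isGap fun q hq => hs' (hsup s q hs.1 hq)).exists_image_eq
      (ht.isGap fun q hq => ht' (hsup t q ht.1 hq))
    refine ⟨f, _, rfl, sameSup_of_upperBounds_eq rat_trans (hs.1.conj f) ht.1 ?_⟩
    rw [supp_conj, f.upperBounds_image, hf]

theorem ratLike_rat : RatLike ℚ := by
  obtain ⟨g', u, v, hu, hv, huv, hT⟩ := exists_shift
  obtain ⟨g, hg⟩ := exists_affine one_pos 1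
  obtain ⟨k₀, hk₀, hirr⟩ := exists_bump (huv 0).2.1
  have hg' : ∀ n, supp (zconj g' k₀ n) = Set.Ioo (u n) (v n) := fun n => by
    rw [supp_zconj, hk₀, OrderIso.image_Ioo, zpow_apply_eq hu, zpow_apply_eq hv, zero_add]
  have hgn : ∀ (n : ℤ) (x : ℚ), (g ^ n : ℚ ≃o ℚ) x = x + n := fun n x => by
    have := zpow_apply_eq (g := g) (f := fun m => x + m)
      (fun m => by rw [hg]; push_cast; ring) n 0
    simpa using this
  have hgg' : ∀ n m, supp (zconj g (zconj g' k₀ n) m) = Set.Ioo (u n + m) (v n + m) :=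
    fun n m => by rw [supp_zconj, hg', OrderIso.image_Ioo, hgn, hgn]
  obtain ⟨k, hk, hatom⟩ := exists_irrComm_glue (g := g') hirr (c := 0) fun n => by
    rw [hg']
    refine Set.Ioo_subset_Ioo ?_ ?_ <;> push_cast <;> linarith [huv n]
  refine ratLike_of_intervals (g := g) hk ?_ ?_
  · intro a ha
    obtain ⟨m, n, rfl⟩ := ha.eq_zconj hk (by simpa only [zconj_zero] using hatom 0)
    refine ⟨v n + m, ?_⟩
    rw [hgg']
    exact isLUB_Ioo (by linarith [huv n])
  · intro p q hpq
    have hmem : ∀ n m, Mem g k (zconj g (zconj g' k₀ n) m) := by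
      intro n m
      obtain ⟨b, hb, hb'⟩ := exists_irrComm_glue (g := g) (hatom n).2 (c := n) fun m => by
        rw [hgg']
        refine Set.Ioo_subset_Ioo ?_ ?_ <;> push_cast <;> linarith [huv n]
      exact ⟨b, hb, hb' m, _, by simpa only [zconj_zero] using hb' 0, hatom n⟩
    have h1 := Int.ceil_lt_add_one q
    have h2 := Int.le_ceil q
    obtain ⟨r, hr, hrq⟩ : ∃ r, max p (⌈q⌉ - 1) < r ∧ r < q :=
      exists_between (max_lt hpq (by linarith))
    rw [max_lt_iff] at hr
    obtain ⟨n, hn1, hn2⟩ := hT (r - (⌈q⌉ - 1)) (q - (⌈q⌉ - 1)) (by linarith) (by linarith)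
      (by linarith)
    refine ⟨_, hmem n (⌈q⌉ - 1 - n), ?_⟩
    have e : supp (zconj g (zconj g' k₀ n) (⌈q⌉ - 1 - n)) = Set.Ioo r q := by
      rw [hgg', hn1, hn2]
      push_cast
      congr 1 <;> ring
    rw [e]
    exact ⟨Set.Ioo_subset_Ioo hr.1.le le_rfl, isLUB_Ioo hrq⟩

end Rationals

end ElementaryEquivalence

/-- If `Aut(Ω,≤)` acts transitively on `Ω` and is elementarily
equivalent to `Aut(ℚ,≤)` in the first-order language of lattice-ordered groups,
then `Ω ≅ ℚ` or `Ω ≅ ℝ ∖ ℚ` as ordered sets. -/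
theorem elem_equiv_rat (Ω : Type*) [LinearOrder Ω]
    (htrans : ∀ α β : Ω, ∃ g : Ω ≃o Ω, g α = β)
    (heq : LGLang.ElementarilyEquivalent (Ω ≃o Ω) (ℚ ≃o ℚ)) :
    Nonempty (Ω ≃o ℚ) ∨ Nonempty (Ω ≃o {x : ℝ // Irrational x}) := by
  exact RatLike.orderIso htrans (ratLike_of_elementarilyEquivalent heq ratLike_rat)

end LPerm
end

section
/- Let (G,Ω) be an ample transitive ℓ-permutation group whose spine 𝔎 has no minimal element, let Δ ∈ T and h ∈ Q_Δ. Then: (a) the centralizer C_G(X_h) contains the pointwise stabilizer of Δ in G and is contained in the pointwise stabilizer of supp(h) in G; (b) W_h = ⋃{X_{h^g} | g ∈ st(Δ)}; (c) C_G(W_h) equals the pointwise stabilizer of Δ in G. -/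
/-!  Common framework for ℓ-permutation groups on a totally ordered set. -/

namespace LPerm

variable {Ω : Type*} [LinearOrder Ω]

namespace IsConvexCongruence

variable {G : Subgroup (Ω ≃o Ω)} {r s : Ω → Ω → Prop}

lemma left_of_between (hr : IsConvexCongruence G r) {a b c : Ω} (h : r a c)
    (hab : a ≤ b) (hbc : b ≤ c) : r a b :=
  hr.2.1 a b c h hab hbc

lemma right_of_between (hr : IsConvexCongruence G r) {a b c : Ω} (h : r a c)
    (hab : a ≤ b) (hbc : b ≤ c) : r b c :=
  hr.1.trans (hr.1.symm (hr.left_of_between h hab hbc)) h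

lemma map_iff (hr : IsConvexCongruence G r) {g : Ω ≃o Ω} (hg : g ∈ G) {a b : Ω} :
    r (g a) (g b) ↔ r a b := by
  refine ⟨fun h => ?_, hr.2.2 g hg a b⟩
  simpa using hr.2.2 g⁻¹ (inv_mem hg) _ _ h

lemma inv_left_iff (hr : IsConvexCongruence G r) {g : Ω ≃o Ω} (hg : g ∈ G) {a b : Ω} :
    r (g⁻¹ a) b ↔ r a (g b) := by
  rw [← hr.map_iff hg]; simp

/-- The convex congruences of a transitive group form a chain; this is the pointwise form, with the
two witnesses of incomparability on opposite sides of the base point. -/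
lemma not_crossing (htrans : IsTransitive G) (hr : IsConvexCongruence G r)
    (hs : IsConvexCongruence G s) {a b c : Ω} (hba : b < a) (hac : a < c)
    (hrb : r a b) (hsb : ¬ s a b) (hsc : s a c) : r a c := by
  obtain ⟨g, hg, hgab⟩ := htrans a b
  have hbc : s b (g c) := hgab ▸ hs.2.2 g hg _ _ hsc
  have hlt : b < g c := by rw [← hgab]; exact g.strictMono hac
  have hca : g c < a := by
    by_contra! hle
    exact hsb (hs.1.symm (hs.left_of_between hbc hba.le hle))
  have h1 : r b (g c) := hr.left_of_between (hr.1.symm hrb) hlt.le hca.le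
  rw [← hgab, hr.map_iff hg] at h1
  exact h1

lemma not_incomparable (htrans : IsTransitive G) (hr : IsConvexCongruence G r)
    (hs : IsConvexCongruence G s) {a b c : Ω} (hrb : r a b) (hsb : ¬ s a b)
    (hsc : s a c) : r a c := by
  rcases lt_trichotomy a b with hab | rfl | hba
  · rcases le_total a c with hac | hca
    · rcases le_total b c with hbc | hcb
      · exact absurd (hs.left_of_between hsc hab.le hbc) hsb
      · exact hr.left_of_between hrb hac hcb
    · rcases hca.eq_or_lt with rfl | hca
      · exact hr.1.refl _
      · by_contra hrc
        exact hsb (not_crossing htrans hs hr hca hab hsc hrc hrb)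
  · exact absurd (hs.1.refl _) hsb
  · rcases le_total c a with hca | hac
    · rcases le_total c b with hcb | hbc
      · exact absurd (hs.1.symm (hs.right_of_between (hs.1.symm hsc) hcb hba.le)) hsb
      · exact hr.1.symm (hr.right_of_between (hr.1.symm hrb) hbc hca)
    · rcases hac.eq_or_lt with rfl | hac
      · exact hr.1.refl _
      · exact not_crossing htrans hr hs hba hac hrb hsb hsc

lemma le_total (htrans : IsTransitive G) (hr : IsConvexCongruence G r)
    (hs : IsConvexCongruence G s) : relLe r s ∨ relLe s r := by
  by_contra! hcon
  obtain ⟨h1, h2⟩ := hcon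
  simp only [relLe, not_forall] at h1 h2
  obtain ⟨a, b, hrb, hsb⟩ := h1
  obtain ⟨c, d, hsd, hrd⟩ := h2
  obtain ⟨g, hg, rfl⟩ := htrans c a
  refine hrd ((hr.map_iff hg).1 (not_incomparable htrans hr hs hrb hsb ?_))
  exact hs.2.2 g hg _ _ hsd

end IsConvexCongruence

section Congruences

variable {G : Subgroup (Ω ≃o Ω)}

lemma isConvexCongruence_eq : IsConvexCongruence G (fun a b : Ω => a = b) := by
  refine ⟨⟨fun _ => rfl, fun h => h.symm, fun h h' => h.trans h'⟩, ?_, ?_⟩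
  · rintro a b _ rfl h1 h2
    exact le_antisymm h1 h2
  · rintro g _ a _ rfl
    rfl

lemma isConvexCongruence_Vcong (a b : Ω) : IsConvexCongruence G (Vcong G a b) := by
  refine ⟨⟨fun _ r hr _ => hr.1.refl _, fun h r hr hab => hr.1.symm (h r hr hab),
    fun h h' r hr hab => hr.1.trans (h r hr hab) (h' r hr hab)⟩, ?_, ?_⟩
  · exact fun x y z h h1 h2 r hr hab => hr.2.1 x y z (h r hr hab) h1 h2
  · exact fun g hg x y h r hr hab => hr.2.2 g hg x y (h r hr hab)

lemma Vcong_self (a b : Ω) : Vcong G a b a b := fun _ _ hab => hab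

/-- The largest convex congruence separating two given distinct points. -/
lemma isConvexCongruence_not_Vcong (htrans : IsTransitive G) {a b : Ω} (hab : a ≠ b) :
    IsConvexCongruence G (fun x y => ¬ Vcong G x y a b) := by
  have key : ∀ x y, ¬ Vcong G x y a b ↔
      ∃ r, IsConvexCongruence G r ∧ r x y ∧ ¬ r a b := by
    intro x y
    simp only [Vcong, not_forall, exists_prop]
  simp only [key]
  refine ⟨⟨fun x => ⟨_, isConvexCongruence_eq, rfl, hab⟩, ?_, ?_⟩, ?_, ?_⟩
  · rintro x y ⟨r, hr, h, h'⟩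
    exact ⟨r, hr, hr.1.symm h, h'⟩
  · rintro x y z ⟨r, hr, h, h'⟩ ⟨s, hs, k, k'⟩
    rcases hr.le_total htrans hs with hle | hle
    · exact ⟨s, hs, hs.1.trans (hle _ _ h) k, k'⟩
    · exact ⟨r, hr, hr.1.trans h (hle _ _ k), h'⟩
  · rintro x y z ⟨r, hr, h, h'⟩ h1 h2
    exact ⟨r, hr, hr.2.1 x y z h h1 h2, h'⟩
  · rintro g hg x y ⟨r, hr, h, h'⟩
    exact ⟨r, hr, hr.2.2 g hg x y h, h'⟩

lemma ne_of_mem_Qset (htrans : IsTransitive G) {Δ : Set Ω} (hΔ : InT G Δ) {h : Ω ≃o Ω} {α : Ω}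
    (hα : Δ = {γ | Vcong G α (h α) α γ}) : h α ≠ α := by
  intro heq
  have hsub : ∀ γ ∈ Δ, α = γ := by
    intro γ hγ
    rw [hα] at hγ
    exact hγ _ isConvexCongruence_eq heq.symm
  obtain ⟨r, ⟨a, b, hab, rfl⟩, δ, rfl⟩ := hΔ
  obtain ⟨g, hg, rfl⟩ := htrans a δ
  have h1 := hsub (g a) ((isConvexCongruence_Vcong a b).1.refl _)
  have h2 := hsub (g b) ((isConvexCongruence_Vcong a b).2.2 g hg _ _ (Vcong_self a b))
  exact hab (g.injective (h1.symm.trans h2))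

/-- A nontrivial element of `G` supported on an o-block of `α` avoiding two given points. -/
lemma exists_small_support (htrans : IsTransitive G) (hample : Ample G) (hnomin : SpineNoMin G)
    {α p q : Ω} (hp : α ≠ p) (hq : α ≠ q) :
    ∃ r, IsConvexCongruence G r ∧ ¬ r α p ∧ ¬ r α q ∧
      ∃ g ∈ G, (∀ γ, g γ ≠ γ → r α γ) ∧ ∃ β, g β ≠ β := by
  have key : ∀ p q : Ω, α ≠ p → relLe (Vcong G α p) (Vcong G α q) →
      ∃ r, SpineMem G r ∧ ¬ r α p ∧ ¬ r α q := by
    intro p q hp hle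
    obtain ⟨r, hr, hrle, hrne⟩ := hnomin (Vcong G α p) ⟨α, p, hp, rfl⟩
    have hrc : IsConvexCongruence G r := by
      obtain ⟨a, b, -, rfl⟩ := hr
      exact isConvexCongruence_Vcong a b
    have hrp : ¬ r α p := by
      intro h
      refine hrne (funext fun x => funext fun y => propext ⟨hrle x y, fun hxy => hxy r hrc h⟩)
    refine ⟨r, hr, hrp, fun h => hrp ?_⟩
    exact hle _ _ (Vcong_self α p) r hrc h
  obtain ⟨r, hr, hrp, hrq⟩ : ∃ r, SpineMem G r ∧ ¬ r α p ∧ ¬ r α q := by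
    rcases (isConvexCongruence_Vcong α p).le_total htrans (isConvexCongruence_Vcong α q)
      with hle | hle
    · exact key p q hp hle
    · obtain ⟨r, hr, h1, h2⟩ := key q p hq hle
      exact ⟨r, hr, h2, h1⟩
  have hT : InT G {γ | r α γ} := ⟨r, hr, α, rfl⟩
  obtain ⟨g, ⟨hg, hsupp⟩, β, -, hβ⟩ := hample _ hT
  obtain ⟨a, b, -, rfl⟩ := hr
  exact ⟨_, isConvexCongruence_Vcong a b, hrp, hrq, g, hg, fun γ hγ => hsupp hγ, β,
    ne_of_mem_Qset htrans hT hβ⟩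

end Congruences

section Elements

lemma inv_apply_eq_self_iff {g : Ω ≃o Ω} {γ : Ω} : g⁻¹ γ = γ ↔ g γ = γ := by
  constructor <;> intro h
  · conv_lhs => rw [← h]
    simp
  · conv_lhs => rw [← h]
    simp

lemma aconj_apply (h g : Ω ≃o Ω) (γ : Ω) : aconj h g γ = g⁻¹ (h (g γ)) := rfl

lemma pcomm_inv_apply (h k : Ω ≃o Ω) (γ : Ω) :
    pcomm h⁻¹ k γ = h (k⁻¹ (h⁻¹ (k γ))) := by
  simp [pcomm]

lemma aconj_mem {G : Subgroup (Ω ≃o Ω)} {h g : Ω ≃o Ω} (hh : h ∈ G) (hg : g ∈ G) :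
    aconj h g ∈ G :=
  mul_mem (mul_mem (inv_mem hg) hh) hg

lemma aconj_mul (h g k : Ω ≃o Ω) : aconj (aconj h g) k = aconj h (g * k) := by
  simp [aconj, mul_assoc]

lemma aconj_apply_ne_iff {h g : Ω ≃o Ω} {γ : Ω} :
    aconj h g γ ≠ γ ↔ h (g γ) ≠ g γ := by
  rw [aconj_apply, Ne, Ne, not_iff_not]
  constructor
  · intro h1
    have := congrArg g h1
    simpa using this
  · intro h1
    simp [h1]

lemma pcomm_eq_one_iff {a b : Ω ≃o Ω} : pcomm a b = 1 ↔ a * b = b * a := by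
  rw [pcomm, mul_assoc, mul_assoc, inv_mul_eq_one, eq_inv_mul_iff_mul_eq, eq_comm]

lemma mul_comm_of_disjoint_supp {f x : Ω ≃o Ω} (h : ∀ γ, f γ = γ ∨ x γ = γ) :
    x * f = f * x := by
  ext γ
  change x (f γ) = f (x γ)
  rcases h γ with hf | hx
  · rw [hf]
    rcases h (x γ) with h1 | h1
    · exact h1.symm
    · rw [x.injective h1, hf]
  · rw [hx]
    rcases h (f γ) with h1 | h1
    · rw [f.injective h1, hx]
    · exact h1

/-- Commutators `[h⁻¹, h^g]` are supported on any o-block containing the support of `h`. -/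
lemma supp_Xset {G : Subgroup (Ω ≃o Ω)} {r : Ω → Ω → Prop} (hr : IsConvexCongruence G r)
    {h : Ω ≃o Ω} {α : Ω} (hsupp : ∀ γ, h γ ≠ γ → r α γ) {x : Ω ≃o Ω}
    (hx : x ∈ Xset G h) {γ : Ω} (hγ : x γ ≠ γ) : r α γ := by
  obtain ⟨g, hg, rfl⟩ := hx
  by_contra hcon
  apply hγ
  have hfix : ∀ δ, ¬ r α δ → h δ = δ := fun δ hδ => by_contra fun hne => hδ (hsupp δ hne)
  have hk : ¬ r α (aconj h g γ) := by
    intro h1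
    by_cases h2 : aconj h g γ = γ
    · exact hcon (h2 ▸ h1)
    · have h3 := hsupp _ (aconj_apply_ne_iff.1 h2)
      have h4 : h (g (aconj h g γ)) ≠ g (aconj h g γ) := by
        rw [← aconj_apply_ne_iff]
        exact fun h5 => h2 ((aconj h g).injective h5)
      have h5 := (hr.map_iff hg).1 (hr.1.trans (hr.1.symm (hsupp _ h4)) h3)
      exact hcon (hr.1.trans h1 h5)
  rw [pcomm_inv_apply, inv_apply_eq_self_iff.2 (hfix _ hk)]
  simpa using hfix _ hcon

lemma ptStab_subset_cent_Xset {G : Subgroup (Ω ≃o Ω)} {r : Ω → Ω → Prop}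
    (hr : IsConvexCongruence G r) {h : Ω ≃o Ω} {α : Ω}
    (hsupp : ∀ γ, h γ ≠ γ → r α γ) : ptStab G {γ | r α γ} ⊆ cent G (Xset G h) := by
  rintro f ⟨hf, hfix⟩
  refine ⟨hf, fun x hx => mul_comm_of_disjoint_supp fun γ => ?_⟩
  by_cases hγ : r α γ
  · exact Or.inl (hfix γ hγ)
  · exact Or.inr (by_contra fun hne => hγ (supp_Xset hr hsupp hx hne))

end Elements

section SmallSupport

variable {G : Subgroup (Ω ≃o Ω)} {r : Ω → Ω → Prop}

lemma not_rel_iterate (hr : IsConvexCongruence G r) {f : Ω ≃o Ω} {β : Ω}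
    (h : ¬ r β (f β)) : ¬ r β (f (f β)) ∧ ¬ r β (f (f (f β))) := by
  rcases le_total β (f β) with hle | hle
  · have h1 := f.monotone hle
    have h2 := f.monotone h1
    exact ⟨fun h3 => h (hr.left_of_between h3 hle h1),
      fun h3 => h (hr.left_of_between h3 hle (h1.trans h2))⟩
  · have h1 := f.monotone hle
    have h2 := f.monotone h1
    exact ⟨fun h3 => h (hr.1.symm (hr.right_of_between (hr.1.symm h3) h1 hle)),
      fun h3 => h (hr.1.symm (hr.right_of_between (hr.1.symm h3) (h2.trans h1) hle))⟩

variable {g h : Ω ≃o Ω} {α : Ω}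

lemma pcomm_conj_apply_of_rel (hr : IsConvexCongruence G r) (hh : h ∈ G)
    (hsupp : ∀ γ, g γ ≠ γ → r α γ) (hα : ¬ r α (h α)) {β : Ω} (hβ : r α β) :
    pcomm h⁻¹ (aconj h g) β = g (g β) := by
  have hfix : ∀ δ, ¬ r α δ → g⁻¹ δ = δ := fun δ hδ =>
    inv_apply_eq_self_iff.2 (by_contra fun hne => hδ (hsupp δ hne))
  have hgα : ∀ γ, r α γ → r α (g γ) := by
    intro γ hγ
    by_cases hne : g γ = γ
    · rwa [hne]
    · exact hsupp _ fun h1 => hne (g.injective h1)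
  have h1 : g⁻¹ (h (g β)) = h (g β) := hfix _ fun h2 =>
    hα (hr.1.trans h2 ((hr.map_iff hh).2 (hr.1.symm (hgα _ hβ))))
  have h2 : g⁻¹ (h⁻¹ (g (g β))) = h⁻¹ (g (g β)) := hfix _ fun h2 =>
    hα (hr.1.trans (hgα _ (hgα _ hβ)) ((hr.inv_left_iff hh).1 (hr.1.symm h2)))
  have h3 : (aconj h g)⁻¹ = g⁻¹ * h⁻¹ * g := by simp [aconj, mul_assoc]
  rw [pcomm_inv_apply, h3, aconj_apply, h1]
  change h (g⁻¹ (h⁻¹ (g (h⁻¹ (h (g β)))))) = _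
  rw [show h⁻¹ (h (g β)) = g β by simp, h2]
  simp

lemma pcomm_conj_apply_ne (hr : IsConvexCongruence G r) (hh : h ∈ G)
    (hsupp : ∀ γ, g γ ≠ γ → r α γ) (hα : ¬ r α (h α)) {β : Ω} (hβ : g β ≠ β) :
    pcomm h⁻¹ (aconj h g) β ≠ β := by
  rw [pcomm_conj_apply_of_rel hr hh hsupp hα (hsupp β hβ)]
  intro h1
  rcases lt_or_gt_of_ne hβ with h2 | h2
  · exact ((g.strictMono h2).trans h2).ne h1
  · exact (h2.trans (g.strictMono h2)).ne h1.symm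

lemma rel_of_pcomm_conj_apply_ne (hr : IsConvexCongruence G r) (hh : h ∈ G)
    (hsupp : ∀ γ, g γ ≠ γ → r α γ) {γ : Ω} (hγ : pcomm h⁻¹ (aconj h g) γ ≠ γ) :
    r α γ ∨ r (h α) γ ∨ r (h⁻¹ α) γ := by
  by_contra! hcon
  obtain ⟨h1, h2, h3⟩ := hcon
  have hfix : ∀ δ, ¬ r α δ → g δ = δ := fun δ hδ => by_contra fun hne => hδ (hsupp δ hne)
  have e1 : g γ = γ := hfix _ h1
  have e2 : g⁻¹ (h γ) = h γ :=
    inv_apply_eq_self_iff.2 (hfix _ fun h4 => h3 ((hr.inv_left_iff hh).2 h4))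
  have e3 : g⁻¹ (h⁻¹ γ) = h⁻¹ γ :=
    inv_apply_eq_self_iff.2 (hfix _ fun h4 =>
      h2 (hr.1.symm ((hr.inv_left_iff hh).1 (hr.1.symm h4))))
  have e4 : (aconj h g)⁻¹ = g⁻¹ * h⁻¹ * g := by simp [aconj, mul_assoc]
  apply hγ
  rw [pcomm_inv_apply, e4, aconj_apply, e1, e2]
  change h (g⁻¹ (h⁻¹ (g (h⁻¹ (h γ))))) = _
  rw [show h⁻¹ (h γ) = γ by simp, e1, e3]
  simp

lemma cent_Xset_subset_ptStab (htrans : IsTransitive G) (hample : Ample G)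
    (hnomin : SpineNoMin G) (hh : h ∈ G) : cent G (Xset G h) ⊆ ptStab G (supp h) := by
  rintro f ⟨hf, hcomm⟩
  refine ⟨hf, fun α hα => by_contra fun hfα => ?_⟩
  obtain ⟨r, hr, hrh, hrf, g, hg, hsupp, β, hβ⟩ :=
    exists_small_support htrans hample hnomin (Ne.symm hα) (Ne.symm hfα)
  have hαβ : r α β := hsupp β hβ
  have hfβ : ¬ r β (f β) := fun h1 =>
    hrf (hr.1.trans (hr.1.trans hαβ h1) ((hr.map_iff hf).2 (hr.1.symm hαβ)))
  set x := pcomm h⁻¹ (aconj h g) with hx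
  have hxf : ∀ γ, x (f γ) = f (x γ) := fun γ => DFunLike.congr_fun (hcomm x ⟨g, hg, hx⟩) γ
  have hxβ : x β ≠ β := pcomm_conj_apply_ne hr hh hsupp hrh hβ
  have hstep : ∀ γ, x γ ≠ γ → x (f γ) ≠ f γ := by
    intro γ hγ h1
    rw [hxf] at h1
    exact hγ (f.injective h1)
  have hx1 := hstep _ hxβ
  have hx2 := hstep _ hx1
  have hx3 := hstep _ hx2
  obtain ⟨n2, n3⟩ := not_rel_iterate hr hfβ
  have m1 : ¬ r (f β) (f (f β)) := fun h1 => hfβ ((hr.map_iff hf).1 h1)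
  have m2 : ¬ r (f (f β)) (f (f (f β))) := fun h1 => m1 ((hr.map_iff hf).1 h1)
  have m3 : ¬ r (f β) (f (f (f β))) := fun h1 => n2 ((hr.map_iff hf).1 h1)
  have hβ' : ∀ {γ}, r α γ → r β γ := fun h1 => hr.1.trans (hr.1.symm hαβ) h1
  have hjoin : ∀ {a b c}, r a b → r a c → r b c := fun h1 h2 => hr.1.trans (hr.1.symm h1) h2
  rcases rel_of_pcomm_conj_apply_ne hr hh hsupp hx1 with c1 | c1 | c1
  · exact hfβ (hβ' c1)
  all_goals
    rcases rel_of_pcomm_conj_apply_ne hr hh hsupp hx2 with c2 | c2 | c2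
    · exact n2 (hβ' c2)
    all_goals
      first
      | exact m1 (hjoin c1 c2)
      | rcases rel_of_pcomm_conj_apply_ne hr hh hsupp hx3 with c3 | c3 | c3
        · exact n3 (hβ' c3)
        all_goals first
          | exact m3 (hjoin c1 c3)
          | exact m2 (hjoin c2 c3)

end SmallSupport

section Jumps

variable {G : Subgroup (Ω ≃o Ω)} {E : Ω → Ω → Prop}

/-- The order of the quotient by a convex congruence, pulled back to `Ω`. -/
def QuotLE (E : Ω → Ω → Prop) (x y : Ω) : Prop := x ≤ y ∨ E x y

namespace QuotLE

lemma trans (hE : IsConvexCongruence G E) {x y z : Ω} (h1 : QuotLE E x y)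
    (h2 : QuotLE E y z) : QuotLE E x z := by
  rcases h1 with h1 | h1 <;> rcases h2 with h2 | h2
  · exact Or.inl (h1.trans h2)
  · rcases le_total x z with h3 | h3
    · exact Or.inl h3
    · exact Or.inr (hE.1.symm (hE.left_of_between (hE.1.symm h2) h3 h1))
  · rcases le_total x z with h3 | h3
    · exact Or.inl h3
    · exact Or.inr (hE.1.trans h1 (hE.left_of_between (hE.1.symm h1) h2 h3))
  · exact Or.inr (hE.1.trans h1 h2)

lemma antisymm (hE : IsConvexCongruence G E) {x y : Ω} (h1 : QuotLE E x y)
    (h2 : QuotLE E y x) : E x y := by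
  rcases h1 with h1 | h1
  · rcases h2 with h2 | h2
    · rw [le_antisymm h1 h2]
      exact hE.1.refl _
    · exact hE.1.symm h2
  · exact h1

lemma map (hE : IsConvexCongruence G E) {g : Ω ≃o Ω} (hg : g ∈ G) {x y : Ω}
    (h : QuotLE E x y) : QuotLE E (g x) (g y) :=
  h.imp (fun h => g.monotone h) (hE.2.2 g hg x y)

lemma total (x y : Ω) : QuotLE E x y ∨ QuotLE E y x :=
  (le_total x y).imp Or.inl Or.inl

end QuotLE

/-- `b` lies below a translate of `w` under some `g` carrying `β` below `x`. -/
def Jump (G : Subgroup (Ω ≃o Ω)) (E : Ω → Ω → Prop) (β w x b : Ω) : Prop :=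
  ∃ g ∈ G, QuotLE E (g β) x ∧ QuotLE E b (g w)

namespace Jump

variable {β w : Ω}

lemma mono (hE : IsConvexCongruence G E) {x x' b b' : Ω} (h : Jump G E β w x b)
    (hx : QuotLE E x x') (hb : QuotLE E b' b) : Jump G E β w x' b' := by
  obtain ⟨g, hg, h1, h2⟩ := h
  exact ⟨g, hg, h1.trans hE hx, hb.trans hE h2⟩

lemma map (hE : IsConvexCongruence G E) {k : Ω ≃o Ω} (hk : k ∈ G) {x b : Ω}
    (h : Jump G E β w x b) : Jump G E β w (k x) (k b) := by
  obtain ⟨g, hg, h1, h2⟩ := h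
  exact ⟨k * g, mul_mem hk hg, h1.map hE hk, h2.map hE hk⟩

lemma map_iff (hE : IsConvexCongruence G E) {k : Ω ≃o Ω} (hk : k ∈ G) {x b : Ω} :
    Jump G E β w (k x) (k b) ↔ Jump G E β w x b := by
  refine ⟨fun h => ?_, fun h => h.map hE hk⟩
  simpa using h.map hE (inv_mem hk)

lemma of_quotLE (htrans : IsTransitive G) (hE : IsConvexCongruence G E) (hβw : β ≤ w) {a b : Ω}
    (h : QuotLE E b a) : Jump G E β w a b := by
  obtain ⟨g, hg, rfl⟩ := htrans β a
  exact ⟨g, hg, Or.inl le_rfl, h.trans hE (Or.inl (g.monotone hβw))⟩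

lemma self : Jump G E β w β w := ⟨1, one_mem _, Or.inl le_rfl, Or.inl le_rfl⟩

lemma isConvexCongruence_reach (htrans : IsTransitive G) (hE : IsConvexCongruence G E)
    (hβw : β ≤ w) : IsConvexCongruence G (fun a b =>
      Relation.ReflTransGen (Jump G E β w) a b ∧ Relation.ReflTransGen (Jump G E β w) b a) := by
  refine ⟨⟨fun _ => ⟨.refl, .refl⟩, fun h => ⟨h.2, h.1⟩,
    fun h h' => ⟨h.1.trans h'.1, h'.2.trans h.2⟩⟩, ?_, ?_⟩
  · intro a b c h hab hbc
    exact ⟨h.1.tail (of_quotLE htrans hE hβw (Or.inl hbc)),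
      .single (of_quotLE htrans hE hβw (Or.inl hab))⟩
  · intro g hg a b h
    exact ⟨h.1.lift g fun _ _ h => h.map hE hg, h.2.lift g fun _ _ h => h.map hE hg⟩

lemma reach (htrans : IsTransitive G) (hE : IsConvexCongruence G E) (hβw : β ≤ w) {α : Ω}
    (hmin : ∀ r, IsConvexCongruence G r → r β w → r β α) :
    Relation.ReflTransGen (Jump G E β w) β α :=
  (hmin _ (isConvexCongruence_reach htrans hE hβw)
    ⟨.single self, .single (of_quotLE htrans hE hβw (Or.inl hβw))⟩).1

lemma isConvexCongruence_source (hE : IsConvexCongruence G E) :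
    IsConvexCongruence G (fun b c => ∀ p, Jump G E β w p b ↔ Jump G E β w p c) := by
  refine ⟨⟨fun _ _ => Iff.rfl, fun h p => (h p).symm, fun h h' p => (h p).trans (h' p)⟩, ?_, ?_⟩
  · intro a b c h hab hbc p
    exact ⟨fun hp => ((h p).1 hp).mono hE (Or.inl le_rfl) (Or.inl hbc),
      fun hp => hp.mono hE (Or.inl le_rfl) (Or.inl hab)⟩
  · intro g hg a b h p
    have := h (g⁻¹ p)
    rwa [← map_iff hE hg, ← map_iff hE hg (b := b), show g (g⁻¹ p) = p by simp] at this

end Jump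

variable {H : Ω ≃o Ω}

lemma not_rel_map_congr (hE : IsConvexCongruence G E) (hH : H ∈ G) {p q : Ω} (hpq : E p q)
    (hp : ¬ E p (H p)) : ¬ E q (H q) := fun hq =>
  hp (hE.1.trans (hE.1.trans hpq hq) ((hE.map_iff hH).2 (hE.1.symm hpq)))

/-- Stabilizer orbits are convex, modulo a convex congruence `E`. -/
lemma exists_rel_of_between (hlat : SublatticeClosed G) (htrans : IsTransitive G)
    (hE : IsConvexCongruence G E) {β w q : Ω} {g k : Ω ≃o Ω} (hg : g ∈ G) (hk : k ∈ G)
    (hgβ : QuotLE E (g β) β) (hgw : QuotLE E q (g w))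
    (hkβ : QuotLE E β (k β)) (hkw : QuotLE E (k w) q) :
    ∃ m ∈ G, E (m β) β ∧ E (m w) q := by
  obtain ⟨n, hn, hnw⟩ := htrans w q
  have hv := (hlat g 1 hg (one_mem _)).1
  have ht := (hlat k 1 hk (one_mem _)).2
  refine ⟨autInf (autSup n (autInf k 1)) (autSup g 1), (hlat _ _ (hlat _ _ hn ht).1 hv).2, ?_, ?_⟩
  · change E (min (max (n β) (min (k β) β)) (max (g β) β)) β
    refine QuotLE.antisymm hE ?_ ?_
    · refine QuotLE.trans hE (Or.inl (min_le_right _ _)) ?_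
      rcases le_total (g β) β with h | h
      · rw [max_eq_right h]; exact Or.inl le_rfl
      · rwa [max_eq_left h]
    · refine QuotLE.trans hE (y := min (k β) β) ?_ (Or.inl ?_)
      · rcases le_total (k β) β with h | h
        · rwa [min_eq_left h]
        · rw [min_eq_right h]; exact Or.inl le_rfl
      · exact le_min (le_max_right _ _) ((min_le_right _ _).trans (le_max_right _ _))
  · change E (min (max (n w) (min (k w) w)) (max (g w) w)) q
    rw [hnw]
    refine QuotLE.antisymm hE ?_ ?_
    · refine QuotLE.trans hE (Or.inl (min_le_left _ _)) ?_
      rcases le_total q (min (k w) w) with h | h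
      · rw [max_eq_right h]
        exact QuotLE.trans hE (Or.inl (min_le_left _ _)) hkw
      · rw [max_eq_left h]; exact Or.inl le_rfl
    · rcases le_total (max q (min (k w) w)) (max (g w) w) with h | h
      · rw [min_eq_left h]; exact Or.inl (le_max_left _ _)
      · rw [min_eq_right h]
        exact hgw.trans hE (Or.inl (le_max_left _ _))

/-- If `K` covers `E`, then `β` can be carried by a conjugate of `H` into the set of points
moved by `H` modulo `E`, provided that this set contains a point above `β`. -/
lemma exists_conj_apply_moved (hlat : SublatticeClosed G) (htrans : IsTransitive G)
    (hE : IsConvexCongruence G E) {α β : Ω}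
    (hmin : ∀ r, IsConvexCongruence G r → ∀ x y, r x y → ¬ E x y →
      ∀ p, ¬ E p (H p) → r β p)
    (hH : H ∈ G) (hβα : β < α) (hαH : α < H α) (hα : ¬ E α (H α)) :
    ∃ g ∈ G, ¬ E (aconj H g β) (H (aconj H g β)) := by
  by_contra! hcon
  have hβ : E β (H β) := by
    have := hcon 1 (one_mem _)
    rw [show aconj H 1 β = H β by simp [aconj]] at this
    exact (hE.map_iff hH).1 this
  have hne : ∀ {q}, ¬ E q (H q) → ¬ E β q := fun hq h =>
    not_rel_map_congr hE hH (hE.1.symm h) hq hβ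
  obtain ⟨u, hu, rfl⟩ := htrans β α
  have huw : u (aconj H u β) = H (u β) := by simp [aconj_apply]
  have hβw : β < aconj H u β := by
    rw [← u.lt_iff_lt, huw]
    exact hαH
  have hEβw : ¬ E β (aconj H u β) := by
    rw [← hE.map_iff hu, huw]
    exact hα
  set w := aconj H u β with hw
  by_cases hcase : ∃ q, QuotLE E β q ∧ Jump G E β w β q ∧ ¬ E q (H q)
  · obtain ⟨q, hβq, ⟨g, hg, hgβ, hqw⟩, hq⟩ := hcase
    have hβq' : β ≤ q := hβq.resolve_right (hne hq)
    have hnot : ¬ Jump G E β q β w := by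
      rintro ⟨k, hk, hkβ, hwq⟩
      obtain ⟨m, hm, hmβ, hmw⟩ := exists_rel_of_between hlat htrans hE hg (inv_mem hk) hgβ hqw
        (by simpa using hkβ.map hE (inv_mem hk)) (by simpa using hwq.map hE (inv_mem hk))
      have h1 : aconj H (u * m⁻¹) (m β) = m w := by
        simp [aconj_apply, hw]
      have h2 : E (aconj H (u * m⁻¹) β) q := by
        refine hE.1.trans ?_ hmw
        rw [← h1]
        exact hE.2.2 _ (aconj_mem hH (mul_mem hu (inv_mem hm))) _ _ (hE.1.symm hmβ)
      exact not_rel_map_congr hE hH (hE.1.symm h2) hq (hcon _ (mul_mem hu (inv_mem hm)))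
    have hreach := Jump.reach htrans hE hβq'
      (fun r hr h => hmin r hr _ _ h (hne hq) _ hα)
    have hinv : ∀ b, Relation.ReflTransGen (Jump G E β q) β b →
        ∀ j : ℕ, ¬ QuotLE E (u β) ((H ^ j) b) := by
      intro b hb
      induction hb with
      | refl =>
        intro j h
        have hj : E ((H ^ j) β) β := by
          induction j with
          | zero => exact hE.1.refl _
          | succ j ih =>
            have ih := ih ?_
            · rw [pow_succ']
              exact hE.1.trans (hE.2.2 H hH _ _ ih) (hE.1.symm hβ)
            · have h' := h
              rw [pow_succ] at h'
              exact h'.trans hE (Or.inr (hE.2.2 _ (pow_mem hH j) _ _ (hE.1.symm hβ)))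
        exact hne hα (QuotLE.antisymm hE (Or.inl hβα.le) (h.trans hE (Or.inr hj)))
      | @tail a b _ hab ih =>
        intro j h
        have h1 := hab.map hE (pow_mem hH (j + 1))
        have h2 : QuotLE E (H (u β)) ((H ^ (j + 1)) b) := by
          rw [pow_succ']
          exact h.map hE hH
        have h3 : Jump G E β q (u β) (u w) :=
          huw ▸ h1.mono hE ((QuotLE.total _ _).resolve_right (ih (j + 1))) h2
        exact hnot ((Jump.map_iff hE hu).1 h3)
    exact hinv _ hreach 0 (Or.inl le_rfl)
  · push Not at hcase
    have hreach := Jump.reach htrans hE hβw.le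
      (fun r hr h => hmin r hr _ _ h hEβw _ hα)
    have hinv : ∀ a, Relation.ReflTransGen (Jump G E β w) β a →
        ∀ b, QuotLE E β b → QuotLE E b a → E b (H b) := by
      intro a ha
      induction ha with
      | refl =>
        intro b h1 h2
        exact hcase b h1 (Jump.of_quotLE htrans hE hβw.le h2)
      | @tail a c _ hac ih =>
        intro b h1 h2
        by_contra hb
        have hab : Jump G E β w a b := hac.mono hE (Or.inl le_rfl) h2
        have hβb : ¬ Jump G E β w β b := fun h => hb (hcase b h1 h)
        have hβa : QuotLE E β a := (QuotLE.total β a).resolve_right fun h =>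
          hβb (hab.mono hE h (Or.inl le_rfl))
        have haH : E a (H a) := ih a hβa (Or.inl le_rfl)
        have hsame : ∀ p, Jump G E β w p b ↔ Jump G E β w p (H b) := by
          suffices hs : ∀ p, Jump G E β w (H p) b ↔ Jump G E β w p b by
            intro p
            have := hs (H⁻¹ p)
            rw [← Jump.map_iff hE hH (x := H⁻¹ p), show H (H⁻¹ p) = p by simp] at this
            exact this
          intro p
          rcases QuotLE.total a p with hap | hpa
          · have hap' : QuotLE E a (H p) := QuotLE.trans hE (Or.inr haH) (hap.map hE hH)
            exact iff_of_true (hab.mono hE hap' (Or.inl le_rfl))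
              (hab.mono hE hap (Or.inl le_rfl))
          · rcases QuotLE.total β p with hβp | hpβ
            · have hp := ih p hβp hpa
              exact ⟨fun h => h.mono hE (Or.inr (hE.1.symm hp)) (Or.inl le_rfl),
                fun h => h.mono hE (Or.inr hp) (Or.inl le_rfl)⟩
            · have hpβ' : QuotLE E (H p) β :=
                (hpβ.map hE hH).trans hE (Or.inr (hE.1.symm hβ))
              exact iff_of_false (fun h => hβb (h.mono hE hpβ' (Or.inl le_rfl)))
                (fun h => hβb (h.mono hE hpβ (Or.inl le_rfl)))
        have := hmin _ (Jump.isConvexCongruence_source hE) _ _ hsame hb b hb β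
        exact hβb (this.1 (Jump.of_quotLE htrans hE hβw.le (Or.inl le_rfl)))
    exact hα (hinv _ hreach _ (Or.inl hβα.le) (Or.inl le_rfl))

end Jumps

section Commuting

variable {G : Subgroup (Ω ≃o Ω)}

/-- A point fixed by `h` and by all of `X_h` is carried outside `supp h` by conjugates of `h`. -/
lemma conj_apply_fixed {h : Ω ≃o Ω} {β : Ω} (hβ : h β = β)
    (hX : ∀ x ∈ Xset G h, x β = β) {g : Ω ≃o Ω} (hg : g ∈ G) :
    h (aconj h g β) = aconj h g β := by
  have h1 := hX _ ⟨g, hg, rfl⟩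
  rw [pcomm_inv_apply] at h1
  have h2 : (aconj h g)⁻¹ (h⁻¹ (aconj h g β)) = β := h.injective (h1.trans hβ.symm)
  rw [← inv_apply_eq_self_iff]
  have h3 := congrArg (aconj h g) h2
  simpa using h3

lemma Xset_subset (h : Ω ≃o Ω) (hh : h ∈ G) : Xset G h ⊆ G := by
  rintro _ ⟨g, hg, rfl⟩
  have hk := aconj_mem hh hg
  exact mul_mem (mul_mem (mul_mem (inv_mem (inv_mem hh)) (inv_mem hk)) (inv_mem hh)) hk

lemma eq_of_forall_Xset_apply_eq (htrans : IsTransitive G) (hample : Ample G)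
    (hnomin : SpineNoMin G) {h k : Ω ≃o Ω} (hk : k ∈ G) (hh : h ∈ G)
    (hX : ∀ x ∈ Xset G k, ∀ γ, h γ ≠ γ → x γ = γ) {β : Ω} (hβ : k β ≠ β) : h β = β := by
  by_contra hhβ
  obtain ⟨r, hr, hrh, hrk, g, hg, hsupp, γ, hγ⟩ :=
    exists_small_support htrans hample hnomin (Ne.symm hhβ) (Ne.symm hβ)
  refine pcomm_conj_apply_ne hr hk hsupp hrk hγ (hX _ ⟨g, hg, rfl⟩ γ fun h1 => hrh ?_)
  have h2 := hr.2.2 h hh _ _ (hr.1.symm (hsupp γ hγ))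
  rw [h1] at h2
  exact hr.1.trans (hsupp γ hγ) h2

lemma exists_conj_apply_moved_of_ne (hlat : SublatticeClosed G) (htrans : IsTransitive G)
    {h : Ω ≃o Ω} (hh : h ∈ G) {α β : Ω} (hα : h α ≠ α) (hβα : β < α)
    (hsupp : ∀ γ, h γ ≠ γ → Vcong G α (h α) β γ) :
    ∃ g ∈ G, h (aconj h g β) ≠ aconj h g β ∨ h (aconj h⁻¹ g β) ≠ aconj h⁻¹ g β := by
  have hE := isConvexCongruence_not_Vcong htrans (G := G) (Ne.symm hα)
  set E : Ω → Ω → Prop := fun x y => ¬ Vcong G x y α (h α) with hEdef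
  have hmin : ∀ r, IsConvexCongruence G r → ∀ x y, r x y → ¬ E x y →
      ∀ γ, h γ ≠ γ → r β γ := by
    intro r hr x y hxy hnE γ hγ
    exact hsupp γ hγ r hr (not_not.1 hnE r hr hxy)
  have hne : ∀ {H : Ω ≃o Ω} {γ}, ¬ E γ (H γ) → H γ ≠ γ := fun hnE heq =>
    hnE (by rw [heq]; exact hE.1.refl _)
  have hEα : ¬ E α (h α) := fun h1 => h1 (Vcong_self _ _)
  rcases lt_or_gt_of_ne hα with hlt | hlt
  · have hlt' : α < h⁻¹ α := by
      rw [← h.lt_iff_lt]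
      simpa using hlt
    obtain ⟨g, hg, hmoved⟩ := exists_conj_apply_moved hlat htrans hE
      (fun r hr x y hxy hnE γ hγ => hmin r hr x y hxy hnE γ
        fun h1 => hne hγ (inv_apply_eq_self_iff.2 h1)) (inv_mem hh) hβα hlt'
      (fun h1 => hEα ((hE.inv_left_iff hh).1 (hE.1.symm h1)))
    exact ⟨g, hg, Or.inr fun h1 => hne hmoved (inv_apply_eq_self_iff.2 h1)⟩
  · obtain ⟨g, hg, hmoved⟩ := exists_conj_apply_moved hlat htrans hE
      (fun r hr x y hxy hnE γ hγ => hmin r hr x y hxy hnE γ (hne hγ)) hh hβα hlt hEα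
    exact ⟨g, hg, Or.inl (hne hmoved)⟩

lemma aconj_inv (h g : Ω ≃o Ω) : aconj h⁻¹ g = (aconj h g)⁻¹ := by
  simp [aconj, mul_assoc]

/-- Suppose `h` and a conjugate `k` of it have disjoint supports, each fixed pointwise by the
commutator set of the other element. Then no conjugate of `h` or `h⁻¹` maps a point moved by `k`
to a point moved by `h`. -/
lemma conj_apply_not_moved {h t : Ω ≃o Ω} (ht : t ∈ G)
    (hfix : ∀ γ, h γ ≠ γ → aconj h t γ = γ)
    (hXh : ∀ x ∈ Xset G h, ∀ γ, aconj h t γ ≠ γ → x γ = γ)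
    (hXk : ∀ x ∈ Xset G (aconj h t), ∀ γ, h γ ≠ γ → x γ = γ)
    {β : Ω} (hβ : aconj h t β ≠ β) {g : Ω ≃o Ω} (hg : g ∈ G) :
    h (aconj h g β) = aconj h g β ∧ h (aconj h⁻¹ g β) = aconj h⁻¹ g β := by
  refine ⟨conj_apply_fixed (by_contra fun h1 => hβ (hfix β h1))
    (fun x hx => hXh x hx β hβ) hg, by_contra fun hmoved => hβ ?_⟩
  have h1 := conj_apply_fixed (hfix _ hmoved) (fun x hx => hXk x hx _ hmoved)
    (mul_mem (inv_mem ht) hg)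
  have h2 : aconj (aconj h t) (t⁻¹ * g) (aconj h⁻¹ g β) = β := by
    rw [aconj_mul, mul_inv_cancel_left, aconj_inv]
    simp
  rwa [h2] at h1

lemma exists_pcomm_ne_one (hlat : SublatticeClosed G) (htrans : IsTransitive G)
    (hample : Ample G) (hnomin : SpineNoMin G) {h t : Ω ≃o Ω} (hh : h ∈ G) (ht : t ∈ G)
    {α : Ω} (hα : h α ≠ α) (hsupp : ∀ γ, h γ ≠ γ → Vcong G α (h α) α γ)
    (htα : Vcong G α (h α) α (t⁻¹ α)) :
    ∃ a ∈ Xset G h, ∃ b ∈ Xset G (aconj h t), pcomm a b ≠ 1 := by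
  by_contra! hcon
  have hk := aconj_mem hh ht
  have hXk : ∀ x ∈ Xset G (aconj h t), ∀ γ, h γ ≠ γ → x γ = γ := fun x hx γ hγ =>
    (cent_Xset_subset_ptStab htrans hample hnomin hh
      ⟨Xset_subset _ hk hx, fun y hy => pcomm_eq_one_iff.1 (hcon y hy x hx)⟩).2 γ hγ
  have hXh : ∀ x ∈ Xset G h, ∀ γ, aconj h t γ ≠ γ → x γ = γ := fun x hx γ hγ =>
    (cent_Xset_subset_ptStab htrans hample hnomin hk
      ⟨Xset_subset _ hh hx, fun y hy => (pcomm_eq_one_iff.1 (hcon x hx y hy)).symm⟩).2 γ hγ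
  have hkh : ∀ γ, aconj h t γ ≠ γ → h γ = γ := fun γ hγ =>
    eq_of_forall_Xset_apply_eq htrans hample hnomin hk hh hXk hγ
  have hhk : ∀ γ, h γ ≠ γ → aconj h t γ = γ := fun γ hγ => by_contra fun h1 => hγ (hkh γ h1)
  have hβ : aconj h t (t⁻¹ α) ≠ t⁻¹ α := aconj_apply_ne_iff.2 (by simpa using hα)
  have hV := isConvexCongruence_Vcong (G := G) α (h α)
  rcases lt_trichotomy (t⁻¹ α) α with hlt | heq | hlt
  · obtain ⟨g, hg, h1⟩ := exists_conj_apply_moved_of_ne hlat htrans hh hα hlt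
      (fun γ hγ => hV.1.trans (hV.1.symm htα) (hsupp γ hγ))
    obtain ⟨h2, h3⟩ := conj_apply_not_moved ht hhk hXh hXk hβ hg
    exact h1.elim (fun h1 => h1 h2) fun h1 => h1 h3
  · exact hβ (by rw [heq]; exact hhk α hα)
  · have hkt : aconj (aconj h t) t⁻¹ = h := by
      rw [aconj_mul, mul_inv_cancel]; simp [aconj]
    have hVk : relLe (Vcong G α (h α)) (Vcong G (t⁻¹ α) (aconj h t (t⁻¹ α))) := by
      intro x y hxy r hr hr1
      refine hxy r hr ?_
      have h1 : aconj h t (t⁻¹ α) = t⁻¹ (h α) := by simp [aconj_apply]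
      rw [h1, hr.map_iff (inv_mem ht)] at hr1
      exact hr1
    obtain ⟨g, hg, h1⟩ := exists_conj_apply_moved_of_ne hlat htrans hk hβ hlt (fun γ hγ => by
      refine hVk _ _ (hV.1.trans htα ?_)
      have h2 := hV.2.2 _ (inv_mem ht) _ _ (hsupp _ (aconj_apply_ne_iff.1 hγ))
      simpa using h2)
    obtain ⟨h2, h3⟩ := conj_apply_not_moved (h := aconj h t) (inv_mem ht)
      (by rwa [hkt]) (by rwa [hkt]) (by rwa [hkt]) (by rwa [hkt]) hg (β := α)
    exact h1.elim (fun h1 => h1 h2) fun h1 => h1 h3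

end Commuting

section Blocks

variable {G : Subgroup (Ω ≃o Ω)} {r : Ω → Ω → Prop}

lemma mem_stab_block_iff (hr : IsConvexCongruence G r) {α : Ω} {g : Ω ≃o Ω} (hg : g ∈ G) :
    g ∈ stab G {γ | r α γ} ↔ r α (g α) := by
  constructor
  · rintro ⟨-, h⟩
    rw [Set.ext_iff] at h
    exact (h _).1 ⟨α, hr.1.refl α, rfl⟩
  · refine fun h => ⟨hg, Set.ext fun γ => ⟨?_, fun hγ => ⟨g⁻¹ γ, ?_, by simp⟩⟩⟩
    · rintro ⟨δ, hδ, rfl⟩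
      exact hr.1.trans h (hr.2.2 g hg _ _ hδ)
    · exact hr.1.symm ((hr.inv_left_iff hg).2 (hr.1.trans (hr.1.symm hγ) h))

lemma supp_aconj (hr : IsConvexCongruence G r) {h g : Ω ≃o Ω} (hg : g ∈ G) {α : Ω}
    (hsupp : ∀ γ, h γ ≠ γ → r α γ) {γ : Ω} (hγ : aconj h g γ ≠ γ) : r (g⁻¹ α) γ :=
  (hr.inv_left_iff hg).2 (hsupp _ (aconj_apply_ne_iff.1 hγ))

end Blocks

/-- (Lemma 4.3 of the paper.) -/
theorem centralizer_lemma {Ω : Type*} [LinearOrder Ω]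
    (G : Subgroup (Ω ≃o Ω)) (hlat : SublatticeClosed G)
    (htrans : IsTransitive G) (hample : Ample G) (hnomin : SpineNoMin G)
    (Δ : Set Ω) (hΔ : InT G Δ) (h : Ω ≃o Ω) (hh : h ∈ Qset G Δ) :
    (ptStab G Δ ⊆ cent G (Xset G h) ∧ cent G (Xset G h) ⊆ ptStab G (supp h)) ∧
    (Wset G h = {x | ∃ g ∈ stab G Δ, x ∈ Xset G (aconj h g)}) ∧
    (cent G (Wset G h) = ptStab G Δ) := by
  obtain ⟨⟨hhG, hsub⟩, α, hαΔ, hΔα⟩ := hh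
  have hα : h α ≠ α := ne_of_mem_Qset htrans hΔ hΔα
  have hV := isConvexCongruence_Vcong (G := G) α (h α)
  have hsupp : ∀ γ, h γ ≠ γ → Vcong G α (h α) α γ := fun γ hγ => by
    have := hsub hγ
    rwa [hΔα] at this
  have hstab : ∀ {g}, g ∈ G → (g ∈ stab G Δ ↔ Vcong G α (h α) α (g α)) := fun {g} hg => by
    rw [← mem_stab_block_iff hV hg, ← hΔα]
  have hW : Wset G h = {x | ∃ g ∈ stab G Δ, x ∈ Xset G (aconj h g)} := by
    ext x
    constructor
    · rintro ⟨g, hg, ⟨a, ha, b, hb, hab⟩, hx⟩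
      refine ⟨g, (hstab hg).2 (by_contra fun hcon => hab ?_), hx⟩
      refine pcomm_eq_one_iff.2 (mul_comm_of_disjoint_supp fun γ => ?_)
      by_contra! hne
      have h1 := supp_Xset hV (fun γ hγ => supp_aconj hV hg hsupp hγ) hb hne.1
      have h2 := supp_Xset hV hsupp ha hne.2
      exact hcon ((hV.inv_left_iff hg).1 (hV.1.trans h1 (hV.1.symm h2)))
    · rintro ⟨g, hg, hx⟩
      refine ⟨g, hg.1, exists_pcomm_ne_one hlat htrans hample hnomin hhG hg.1 hα hsupp ?_, hx⟩
      exact hV.1.symm ((hV.inv_left_iff hg.1).2 ((hstab hg.1).1 hg))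
  refine ⟨⟨?_, cent_Xset_subset_ptStab htrans hample hnomin hhG⟩, hW, ?_⟩
  · rw [hΔα]
    exact ptStab_subset_cent_Xset hV hsupp
  · rw [hW]
    ext f
    constructor
    · rintro ⟨hf, hcomm⟩
      refine ⟨hf, fun γ hγ => ?_⟩
      obtain ⟨g, hg, hgγ⟩ := htrans γ α
      rw [hΔα] at hγ
      have hgst : g ∈ stab G Δ := by
        rw [hstab hg]
        have := hV.2.2 g hg _ _ (hV.1.symm hγ)
        rwa [hgγ] at this
      refine (cent_Xset_subset_ptStab htrans hample hnomin (aconj_mem hhG hg)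
        ⟨hf, fun x hx => hcomm x ⟨g, hgst, hx⟩⟩).2 γ (aconj_apply_ne_iff.2 ?_)
      rwa [hgγ]
    · intro hf
      refine ⟨hf.1, ?_⟩
      rintro x ⟨g, hg, hx⟩
      rw [hΔα] at hf
      refine (ptStab_subset_cent_Xset hV (h := aconj h g) (fun γ hγ => ?_) hf).2 x hx
      exact hV.1.trans (hV.1.symm ((hV.inv_left_iff hg.1).2 ((hstab hg.1).1 hg)))
        (supp_aconj hV hg.1 hsupp hγ)

end LPerm
end
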